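/- arXiv:math/0301336 — 5 statements merged into one kernel-verified Lean document; each statement's English description precedes it below -/
import Mathlib

section
/- Let k ≥ 1 and let χ be a character (nonzero multiplicative linear functional) of the Banach algebra A_k(𝔻²). Then there exists a point (λ, μ) in the closed bidisk {(z,w) ∈ ℂ² : |z| ≤ 1, |w| ≤ 1} such that χ(f) = f(λ, μ) for all f ∈ A_k(𝔻²). -/
noncomputable section

/-- The closed bidisk `{(z,w) : ‖z‖ ≤ 1, ‖w‖ ≤ 1}` in `ℂ²`. -/
def Bidisk : Set (ℂ × ℂ) := Metric.closedBall 0 1 ×ˢ Metric.closedBall 0 1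

instance : CompactSpace Bidisk :=
  isCompact_iff_compactSpace.mp ((isCompact_closedBall _ _).prod (isCompact_closedBall _ _))

/-- `g` has the two-variable power series expansion with coefficients `a`,
converging at every point of the open bidisk. -/
def HasCoeffsAt (g : Bidisk → ℂ) (a : ℕ → ℕ → ℂ) : Prop :=
  ∀ p : Bidisk, ‖(p : ℂ × ℂ).1‖ < 1 → ‖(p : ℂ × ℂ).2‖ < 1 →
    HasSum (fun mn : ℕ × ℕ => a mn.1 mn.2 * (p : ℂ × ℂ).1 ^ mn.1 * (p : ℂ × ℂ).2 ^ mn.2) (g p)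

/-- Membership in the bidisk algebra `A(𝔻²)`: a continuous function on the closed bidisk
which is given by a convergent two-variable power series on the open bidisk. -/
def memBidisk (f : C(Bidisk, ℂ)) : Prop := ∃ a : ℕ → ℕ → ℂ, HasCoeffsAt (⇑f) a

/-- Membership in `A_k(𝔻²)`: member of the bidisk algebra whose power series coefficients
`a m n` vanish whenever `k` does not divide `m + n`. -/
def memAk (k : ℕ) (f : C(Bidisk, ℂ)) : Prop :=
  ∃ a : ℕ → ℕ → ℂ, HasCoeffsAt (⇑f) a ∧ ∀ m n : ℕ, ¬ k ∣ (m + n) → a m n = 0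

open Filter Topology

/-- Cauchy's estimate for a power series in one variable bounded on the open unit disk. -/
lemma norm_coeff_le_of_hasSum_of_norm_le {c : ℕ → ℂ} {F : ℂ → ℂ} {M : ℝ}
    (hF : ∀ z : ℂ, ‖z‖ < 1 → HasSum (fun n => c n * z ^ n) (F z))
    (hM : ∀ z : ℂ, ‖z‖ < 1 → ‖F z‖ ≤ M) (n : ℕ) : ‖c n‖ ≤ M := by
  have hball : HasFPowerSeriesOnBall F (.ofScalars ℂ c) 0 1 := by
    refine ⟨?_, one_pos, fun {y} hy => ?_⟩
    · refine ENNReal.le_of_forall_nnreal_lt fun r hr => ?_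
      have hr' : ‖((r : ℝ) : ℂ)‖ < 1 := by simpa using hr
      refine FormalMultilinearSeries.le_radius_of_summable_norm _ ?_
      simpa using (hF _ hr').summable.norm
    · have hy' : ‖y‖ < 1 := by
        rwa [← ENNReal.ofReal_one, Metric.eball_ofReal, mem_ball_zero_iff] at hy
      simpa [FormalMultilinearSeries.ofScalars_apply_eq, mul_comm] using hF y hy'
  have hdiff : DifferentiableOn ℂ F (Metric.ball 0 1) := by
    have := hball.differentiableOn
    rwa [← ENNReal.ofReal_one, Metric.eball_ofReal] at this
  have hcoeff : c n = iteratedDeriv n F 0 / n.factorial := by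
    have h := hball.hasFPowerSeriesAt.eq_formalMultilinearSeries
      hball.analyticAt.hasFPowerSeriesAt
    simpa using congrArg (fun p => p.coeff n) h
  have hest : ∀ r ∈ Set.Ioo (0 : ℝ) 1, ‖c n‖ * r ^ n ≤ M := by
    intro r hr
    have hd : DiffContOnCl ℂ F (Metric.ball 0 r) :=
      (hdiff.mono (by rw [closure_ball _ hr.1.ne']
                      exact Metric.closedBall_subset_ball hr.2)).diffContOnCl
    have h := Complex.norm_iteratedDeriv_le_of_forall_mem_sphere_norm_le n hr.1 hd
      (C := M) fun z hz => hM z (by rw [mem_sphere_zero_iff_norm] at hz; linarith [hr.2])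
    rw [hcoeff, norm_div, Complex.norm_natCast]
    rw [le_div_iff₀ (pow_pos hr.1 n)] at h
    rw [div_mul_eq_mul_div, div_le_iff₀ (by positivity)]
    linarith
  have hlim : Tendsto (fun r : ℝ => ‖c n‖ * r ^ n) (𝓝[<] 1) (𝓝 (‖c n‖ * 1 ^ n)) :=
    ((continuous_const.mul (continuous_pow n)).tendsto 1).mono_left nhdsWithin_le_nhds
  rw [one_pow, mul_one] at hlim
  exact le_of_tendsto hlim (eventually_of_mem (Ioo_mem_nhdsLT one_pos) hest)

lemma mem_bidisk_iff {p : ℂ × ℂ} : p ∈ Bidisk ↔ ‖p.1‖ ≤ 1 ∧ ‖p.2‖ ≤ 1 := by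
  simp [Bidisk, Set.mem_prod]

/-- Cauchy's estimate for the bidisk algebra. -/
lemma HasCoeffsAt.norm_coeff_le {f : C(Bidisk, ℂ)} {a : ℕ → ℕ → ℂ} (h : HasCoeffsAt f a)
    (m n : ℕ) : ‖a m n‖ ≤ ‖f‖ := by
  have hmem : ∀ {z w : ℂ}, ‖z‖ < 1 → ‖w‖ < 1 → (z, w) ∈ Bidisk := fun hz hw =>
    mem_bidisk_iff.2 ⟨hz.le, hw.le⟩
  have hsummable : ∀ w : ℂ, ‖w‖ < 1 → ∀ m, Summable fun n => a m n * w ^ n := by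
    intro w hw m
    have hz : ‖(1 / 2 : ℂ)‖ < 1 := by norm_num
    have := ((h ⟨_, hmem hz hw⟩ hz hw).summable.prod_factor m).mul_left (2 ^ m)
    refine this.congr fun n => ?_
    simp only [one_div, inv_pow]
    field_simp
  have hrow : ∀ w : ℂ, ‖w‖ < 1 → ‖∑' n, a m n * w ^ n‖ ≤ ‖f‖ := by
    intro w hw
    refine norm_coeff_le_of_hasSum_of_norm_le (c := fun m => ∑' n, a m n * w ^ n)
      (F := fun z => if hz : ‖z‖ < 1 then f ⟨(z, w), hmem hz hw⟩ else 0) (fun z hz => ?_)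
      (fun z hz => ?_) m
    · simp only [hz, dite_true]
      refine (h ⟨_, hmem hz hw⟩ hz hw).prod_fiberwise fun m => ?_
      refine ((hsummable w hw m).hasSum.mul_right (z ^ m)).congr_fun fun n => ?_
      ring
    · simp only [hz, dite_true]
      exact f.norm_coe_le_norm _
  exact norm_coeff_le_of_hasSum_of_norm_le (fun w hw => (hsummable w hw m).hasSum) hrow n

lemma hasCoeffsAt_zero : HasCoeffsAt 0 0 := fun p _ _ => by simp [hasSum_zero]

lemma HasCoeffsAt.add {f g : Bidisk → ℂ} {a b : ℕ → ℕ → ℂ} (hf : HasCoeffsAt f a)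
    (hg : HasCoeffsAt g b) : HasCoeffsAt (f + g) (a + b) := fun p hz hw => by
  simpa [add_mul] using (hf p hz hw).add (hg p hz hw)

lemma HasCoeffsAt.const_smul {f : Bidisk → ℂ} {a : ℕ → ℕ → ℂ} (hf : HasCoeffsAt f a) (c : ℂ) :
    HasCoeffsAt (c • f) (c • a) := fun p hz hw => by
  simpa [mul_assoc] using (hf p hz hw).mul_left c

lemma HasCoeffsAt.sub {f g : Bidisk → ℂ} {a b : ℕ → ℕ → ℂ} (hf : HasCoeffsAt f a)
    (hg : HasCoeffsAt g b) : HasCoeffsAt (f - g) (a - b) := fun p hz hw => by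
  simpa [sub_mul] using (hf p hz hw).sub (hg p hz hw)

/-- `A_k(𝔻²)` as a linear subspace of `C(Bidisk, ℂ)`. -/
def akSubmodule (k : ℕ) : Submodule ℂ C(Bidisk, ℂ) where
  carrier := {f | memAk k f}
  zero_mem' := ⟨0, hasCoeffsAt_zero, fun _ _ _ => rfl⟩
  add_mem' := by
    rintro f g ⟨a, ha, ha'⟩ ⟨b, hb, hb'⟩
    exact ⟨a + b, ha.add hb, fun m n h => by simp [ha' m n h, hb' m n h]⟩
  smul_mem' := by
    rintro c f ⟨a, ha, ha'⟩
    exact ⟨c • a, ha.const_smul c, fun m n h => by simp [ha' m n h]⟩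

lemma summable_pow_mul_pow {r s : ℝ} (hr : 0 ≤ r) (hr1 : r < 1) (hs : 0 ≤ s) (hs1 : s < 1) :
    Summable fun mn : ℕ × ℕ => r ^ mn.1 * s ^ mn.2 :=
  (summable_geometric_of_lt_one hr hr1).mul_of_nonneg (summable_geometric_of_lt_one hs hs1)
    (fun _ => pow_nonneg hr _) (fun _ => pow_nonneg hs _)

lemma isClosed_akSubmodule (k : ℕ) : IsClosed (akSubmodule k : Set C(Bidisk, ℂ)) := by
  refine IsSeqClosed.isClosed fun f g hf hfg => ?_
  choose a ha ha' using hf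
  have hlim : ∀ m n, ∃ b, Tendsto (fun j => a j m n) atTop (𝓝 b) := by
    refine fun m n => cauchySeq_tendsto_of_complete ?_
    rw [Metric.cauchySeq_iff]
    intro ε hε
    obtain ⟨N, hN⟩ := Metric.cauchySeq_iff.1 hfg.cauchySeq ε hε
    refine ⟨N, fun i hi j hj => lt_of_le_of_lt ?_ (hN i hi j hj)⟩
    rw [dist_eq_norm, dist_eq_norm]
    exact HasCoeffsAt.norm_coeff_le (f := f i - f j) ((ha i).sub (ha j)) m n
  choose b hb using hlim
  obtain ⟨C, hC⟩ := hfg.norm.bddAbove_range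
  have haC : ∀ j m n, ‖a j m n‖ ≤ C := fun j m n =>
    ((ha j).norm_coeff_le m n).trans (hC ⟨j, rfl⟩)
  have hbC : ∀ m n, ‖b m n‖ ≤ C := fun m n =>
    le_of_tendsto (hb m n).norm (Eventually.of_forall fun j => haC j m n)
  refine ⟨b, fun p hz hw => ?_, fun m n h => ?_⟩
  · have hbound := (summable_pow_mul_pow (norm_nonneg _) hz (norm_nonneg _) hw).mul_left C
    have hterm : ∀ c : ℕ → ℕ → ℂ, (∀ m n, ‖c m n‖ ≤ C) → ∀ mn : ℕ × ℕ,
        ‖c mn.1 mn.2 * (p : ℂ × ℂ).1 ^ mn.1 * (p : ℂ × ℂ).2 ^ mn.2‖ ≤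
          C * (‖(p : ℂ × ℂ).1‖ ^ mn.1 * ‖(p : ℂ × ℂ).2‖ ^ mn.2) := by
      intro c hc mn
      rw [norm_mul, norm_mul, norm_pow, norm_pow, mul_assoc]
      exact mul_le_mul_of_nonneg_right (hc _ _) (by positivity)
    have hsum := tendsto_tsum_of_dominated_convergence (𝓕 := atTop) hbound
      (fun mn => ((hb mn.1 mn.2).mul_const ((p : ℂ × ℂ).1 ^ mn.1)).mul_const
        ((p : ℂ × ℂ).2 ^ mn.2)) (Eventually.of_forall fun j => hterm (a j) (haC j))
    simp_rw [fun j => (ha j p hz hw).tsum_eq] at hsum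
    have hval : Tendsto (fun j => f j p) atTop (𝓝 (g p)) :=
      ((continuous_eval_const p).tendsto g).comp hfg
    rw [tendsto_nhds_unique hval hsum]
    exact (Summable.of_norm_bounded hbound (hterm b hbC)).hasSum
  · exact tendsto_nhds_unique (hb m n) (by simp [ha' _ m n h])

/-- The monomial `z ^ m * w ^ n` on the closed bidisk. -/
def bidiskMonomial (m n : ℕ) : C(Bidisk, ℂ) where
  toFun p := (p : ℂ × ℂ).1 ^ m * (p : ℂ × ℂ).2 ^ n
  continuous_toFun := by fun_prop

lemma bidiskMonomial_apply (m n : ℕ) (p : Bidisk) :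
    bidiskMonomial m n p = (p : ℂ × ℂ).1 ^ m * (p : ℂ × ℂ).2 ^ n := rfl

lemma bidiskMonomial_zero_zero : bidiskMonomial 0 0 = 1 := by
  ext p
  simp [bidiskMonomial_apply]

lemma bidiskMonomial_mul (m n m' n' : ℕ) :
    bidiskMonomial m n * bidiskMonomial m' n' = bidiskMonomial (m + m') (n + n') := by
  ext p
  simp only [ContinuousMap.mul_apply, bidiskMonomial_apply]
  ring

lemma norm_bidiskMonomial_le_one (m n : ℕ) : ‖bidiskMonomial m n‖ ≤ 1 := by
  refine (ContinuousMap.norm_le _ zero_le_one).2 fun p => ?_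
  obtain ⟨h₁, h₂⟩ := mem_bidisk_iff.1 p.2
  rw [bidiskMonomial_apply, norm_mul, norm_pow, norm_pow]
  exact mul_le_one₀ (pow_le_one₀ (norm_nonneg _) h₁) (by positivity)
    (pow_le_one₀ (norm_nonneg _) h₂)

lemma memAk_bidiskMonomial {k m n : ℕ} (h : k ∣ m + n) : memAk k (bidiskMonomial m n) := by
  refine ⟨fun i j => if (i, j) = (m, n) then 1 else 0, fun p _ _ => ?_, fun i j hij => ?_⟩
  · convert hasSum_ite_eq (m, n) (bidiskMonomial m n p) using 2 with ij
    dsimp only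
    split_ifs with h
    · obtain ⟨rfl, rfl⟩ := Prod.ext_iff.1 h
      simp [bidiskMonomial_apply]
    · simp_all
  · refine if_neg ?_
    rintro ⟨⟩
    exact hij h

/-- The monomials of total degree divisible by `k`. -/
def bidiskMonomials (k : ℕ) : Submonoid C(Bidisk, ℂ) where
  carrier := {f | ∃ m n, k ∣ m + n ∧ bidiskMonomial m n = f}
  one_mem' := ⟨0, 0, by simp, bidiskMonomial_zero_zero⟩
  mul_mem' := by
    rintro _ _ ⟨m, n, h, rfl⟩ ⟨m', n', h', rfl⟩
    refine ⟨m + m', n + n', ?_, (bidiskMonomial_mul ..).symm⟩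
    rw [add_add_add_comm]
    exact dvd_add h h'

/-- The closed subalgebra of `C(Bidisk, ℂ)` generated by the monomials of total degree
divisible by `k`. -/
def akSubalgebra (k : ℕ) : Subalgebra ℂ C(Bidisk, ℂ) :=
  (Algebra.adjoin ℂ (bidiskMonomials k : Set C(Bidisk, ℂ))).topologicalClosure

lemma coe_akSubalgebra (k : ℕ) : (akSubalgebra k : Set C(Bidisk, ℂ)) =
    closure (Submodule.span ℂ (bidiskMonomials k : Set C(Bidisk, ℂ)) : Set C(Bidisk, ℂ)) := by
  rw [akSubalgebra, Subalgebra.topologicalClosure_coe, ← Subalgebra.coe_toSubmodule,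
    Algebra.adjoin_eq_span, Submonoid.closure_eq]

lemma memAk_of_mem_akSubalgebra {k : ℕ} {f : C(Bidisk, ℂ)} (hf : f ∈ akSubalgebra k) :
    memAk k f := by
  rw [← SetLike.mem_coe, coe_akSubalgebra] at hf
  refine closure_minimal ?_ (isClosed_akSubmodule k) hf
  refine Submodule.span_le.2 ?_
  rintro _ ⟨m, n, h, rfl⟩
  exact memAk_bidiskMonomial h

lemma bidiskMonomial_mem_akSubalgebra {k m n : ℕ} (h : k ∣ m + n) :
    bidiskMonomial m n ∈ akSubalgebra k :=
  Subalgebra.le_topologicalClosure _ (Algebra.subset_adjoin ⟨m, n, h, rfl⟩)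

/-- Dilation of the closed bidisk by a factor in the unit interval. -/
def bidiskDilation : C(unitInterval × Bidisk, Bidisk) where
  toFun q := ⟨((q.1 : ℝ) : ℂ) • (q.2 : ℂ × ℂ), by
    obtain ⟨h₁, h₂⟩ := mem_bidisk_iff.1 q.2.2
    have h₀ : ‖((q.1 : ℝ) : ℂ)‖ ≤ 1 := by
      rw [Complex.norm_real, Real.norm_of_nonneg q.1.2.1]
      exact q.1.2.2
    refine mem_bidisk_iff.2 ⟨?_, ?_⟩ <;> simp only [Prod.smul_fst, Prod.smul_snd, norm_smul] <;>
      exact mul_le_one₀ h₀ (norm_nonneg _) ‹_›⟩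
  continuous_toFun := by fun_prop

lemma dilation_mem_akSubalgebra {k : ℕ} {f : C(Bidisk, ℂ)} (hf : memAk k f) {r : unitInterval}
    (hr : (r : ℝ) < 1) : (f.comp bidiskDilation).curry r ∈ akSubalgebra k := by
  obtain ⟨a, ha, ha'⟩ := hf
  have hr' : ‖((r : ℝ) : ℂ)‖ < 1 := by
    rwa [Complex.norm_real, Real.norm_of_nonneg r.2.1]
  have hsum : Summable fun mn : ℕ × ℕ =>
      (a mn.1 mn.2 * ((r : ℝ) : ℂ) ^ mn.1 * ((r : ℝ) : ℂ) ^ mn.2) •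
        bidiskMonomial mn.1 mn.2 := by
    refine Summable.of_norm_bounded
      (ha ⟨(r, r), mem_bidisk_iff.2 ⟨hr'.le, hr'.le⟩⟩ hr' hr').summable.norm fun mn => ?_
    rw [norm_smul]
    exact mul_le_of_le_one_right (norm_nonneg _) (norm_bidiskMonomial_le_one _ _)
  have heq : (f.comp bidiskDilation).curry r = ∑' mn : ℕ × ℕ,
      (a mn.1 mn.2 * ((r : ℝ) : ℂ) ^ mn.1 * ((r : ℝ) : ℂ) ^ mn.2) •
        bidiskMonomial mn.1 mn.2 := by
    ext p
    obtain ⟨h₁, h₂⟩ := mem_bidisk_iff.1 p.2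
    have hlt : ∀ x : ℂ, ‖x‖ ≤ 1 → ‖((r : ℝ) : ℂ) * x‖ < 1 := fun x hx => by
      rw [norm_mul]
      exact mul_lt_one_of_nonneg_of_lt_one_left (norm_nonneg _) hr' hx
    have h := ha (bidiskDilation (r, p)) (hlt _ h₁) (hlt _ h₂)
    refine h.unique ?_
    have hp := hsum.hasSum.map (ContinuousMap.evalCLM ℂ p) (ContinuousMap.evalCLM ℂ p).continuous
    refine hp.congr_fun fun mn => ?_
    simp only [bidiskDilation, ContinuousMap.coe_mk, Prod.smul_fst, Prod.smul_snd, smul_eq_mul,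
      Function.comp_apply, ContinuousMap.evalCLM_apply, ContinuousMap.smul_apply,
      bidiskMonomial_apply]
    ring
  rw [heq]
  refine tsum_mem (Subalgebra.isClosed_topologicalClosure _) fun mn => ?_
  by_cases h : k ∣ mn.1 + mn.2
  · exact Subalgebra.smul_mem _ (bidiskMonomial_mem_akSubalgebra h) _
  · rw [ha' _ _ h, zero_mul, zero_mul, zero_smul]
    exact zero_mem _

lemma mem_akSubalgebra_iff {k : ℕ} {f : C(Bidisk, ℂ)} : f ∈ akSubalgebra k ↔ memAk k f := by
  refine ⟨memAk_of_mem_akSubalgebra, fun hf => ?_⟩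
  have hone : (f.comp bidiskDilation).curry 1 = f := by
    ext p
    simp [bidiskDilation]
  have : (𝓝[<] (1 : unitInterval)).NeBot := nhdsLT_neBot_of_exists_lt ⟨0, zero_lt_one⟩
  have hlim := ((f.comp bidiskDilation).curry.continuous.tendsto 1).mono_left
    (nhdsWithin_le_nhds (s := Set.Iio 1))
  rw [hone] at hlim
  exact (Subalgebra.isClosed_topologicalClosure _).mem_of_tendsto hlim
    (eventually_of_mem self_mem_nhdsWithin fun r hr => dilation_mem_akSubalgebra hf hr)

/-- A character of the semigroup of exponents `(m, n)` with `k ∣ m + n`, bounded by one,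
is evaluation at a point of the closed bidisk. -/
lemma exists_bidisk_of_multiplicative {k : ℕ} (hk : 1 ≤ k) {c : ℕ → ℕ → ℂ} (hc₀ : c 0 0 = 1)
    (hc : ∀ m n m' n', k ∣ m + n → k ∣ m' + n' → c (m + m') (n + n') = c m n * c m' n')
    (hle : ∀ m n, k ∣ m + n → ‖c m n‖ ≤ 1) :
    ∃ p : Bidisk, ∀ m n, k ∣ m + n → c m n = (p : ℂ × ℂ).1 ^ m * (p : ℂ × ℂ).2 ^ n := by
  have hk0 : k ≠ 0 := by omega
  have hpow : ∀ m n j, k ∣ m + n → c (j * m) (j * n) = c m n ^ j := by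
    intro m n j h
    induction j with
    | zero => simp [hc₀]
    | succ j ih =>
      rw [add_mul, add_mul, one_mul, one_mul, hc _ _ _ _ _ h, ih, pow_succ]
      rw [← mul_add]
      exact h.mul_left j
  have hroot : ∀ x y : ℂ, x ^ k = y → ‖y‖ ≤ 1 → ‖x‖ ≤ 1 := by
    rintro x _ rfl h
    rw [norm_pow] at h
    exact (pow_le_one_iff_of_nonneg (norm_nonneg _) hk0).1 h
  obtain ⟨l, hl⟩ := IsAlgClosed.exists_pow_nat_eq (c k 0) (n := k) hk
  have hl1 : ‖l‖ ≤ 1 := hroot _ _ hl (hle _ _ (by simp))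
  by_cases hl0 : l = 0
  · obtain ⟨u, hu⟩ := IsAlgClosed.exists_pow_nat_eq (c 0 k) (n := k) hk
    refine ⟨⟨(l, u), mem_bidisk_iff.2 ⟨hl1, hroot _ _ hu (hle _ _ (by simp))⟩⟩, ?_⟩
    intro m n h
    rcases Nat.eq_zero_or_pos m with rfl | hm
    · obtain ⟨j, rfl⟩ : k ∣ n := by simpa using h
      have := hpow 0 k j (by simp)
      rw [mul_zero] at this
      simp only [pow_zero, one_mul]
      rw [mul_comm k j, this, mul_comm j k, pow_mul u, hu]
    · have h0 : c m n ^ k = 0 := by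
        have hkm : c (k * m) (k * n) = c (m * k) 0 * c 0 (n * k) := by
          rw [← hc _ _ _ _ (by simp) (by simp)]
          simp [mul_comm]
        have hm' := hpow k 0 m (by simp)
        rw [mul_zero, ← hl, hl0, zero_pow hk0, zero_pow hm.ne'] at hm'
        rw [← hpow m n k h, hkm, hm', zero_mul]
      simp [hl0, hm.ne', pow_eq_zero_iff hk0 |>.1 h0]
  · obtain ⟨j, rfl⟩ : ∃ j, k = j + 1 := ⟨k - 1, by omega⟩
    set u := c j 1 / l ^ j with hu
    have hcu : c j 1 = l ^ j * u := by rw [hu]; field_simp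
    have hkey : ∀ m n, j + 1 ∣ m + n → c m n = l ^ m * u ^ n := by
      intro m n h
      obtain ⟨i, hi⟩ := h
      have h₁ : c (m + (n * (j + 1))) (n + n * 0) = c m n * (l ^ (j + 1)) ^ n := by
        rw [hc _ _ _ _ ⟨i, hi⟩ (by simp), hpow _ _ _ (by simp), hl]
      have h₂ : c (i * (j + 1) + n * j) (i * 0 + n * 1) =
          (l ^ (j + 1)) ^ i * (l ^ j * u) ^ n := by
        rw [hc _ _ _ _ (by simp) (by rw [← mul_add]; exact Dvd.intro_left _ rfl),
          hpow _ _ _ (by simp), hpow _ _ _ (by simp), hl, hcu]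
      have hexp : m + n * (j + 1) = i * (j + 1) + n * j := by linarith
      rw [hexp, mul_zero, add_zero] at h₁
      rw [mul_zero, mul_one, zero_add, h₁] at h₂
      have hln : (l ^ (j + 1)) ^ n ≠ 0 := pow_ne_zero _ (pow_ne_zero _ hl0)
      refine mul_right_cancel₀ hln (h₂.trans ?_)
      rw [← pow_mul l _ i, ← hi]
      ring
    have huk : u ^ (j + 1) = c 0 (j + 1) := by simp [hkey 0 (j + 1) (by simp)]
    exact ⟨⟨(l, u), mem_bidisk_iff.2 ⟨hl1, hroot _ _ huk (hle _ _ (by simp))⟩⟩, hkey⟩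

/-- Every character of the closed subalgebra generated by the monomials of total degree
divisible by `k` is evaluation at a point of the closed bidisk. -/
lemma exists_eq_eval_of_algHom {k : ℕ} (hk : 1 ≤ k) (φ : akSubalgebra k →ₐ[ℂ] ℂ) :
    ∃ p : Bidisk, ∀ f : akSubalgebra k, φ f = (f : C(Bidisk, ℂ)) p := by
  have hclosed : IsClosed (akSubalgebra k : Set C(Bidisk, ℂ)) :=
    Subalgebra.isClosed_topologicalClosure _
  have : CompleteSpace (akSubalgebra k) := hclosed.completeSpace_coe
  have : Nonempty Bidisk := ⟨⟨0, mem_bidisk_iff.2 (by simp)⟩⟩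
  have hcont : Continuous φ := (AlgHom.toContinuousLinearMap φ).continuous
  have hnorm : ∀ f : akSubalgebra k, ‖φ f‖ ≤ ‖(f : C(Bidisk, ℂ))‖ := fun f => by
    have h := AlgHom.norm_apply_le_self_mul_norm_one φ f
    have h₁ : ‖(1 : akSubalgebra k)‖ = 1 := norm_one (α := C(Bidisk, ℂ))
    rwa [h₁, mul_one] at h
  obtain ⟨p, hp⟩ := exists_bidisk_of_multiplicative hk
    (c := fun m n => if h : k ∣ m + n then φ ⟨_, bidiskMonomial_mem_akSubalgebra h⟩ else 0)
    (by
      simp only [add_zero, dvd_zero, dite_true, bidiskMonomial_zero_zero]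
      exact map_one φ)
    (fun m n m' n' h h' => by
      have h'' : k ∣ m + m' + (n + n') := by
        rw [add_add_add_comm]
        exact dvd_add h h'
      simp only [h, h', h'', dite_true, ← map_mul, ← bidiskMonomial_mul]
      rfl)
    (fun m n h => by
      simp only [h, dite_true]
      exact (hnorm _).trans (norm_bidiskMonomial_le_one m n))
  refine ⟨p, fun f => ?_⟩
  let N : Submodule ℂ C(Bidisk, ℂ) :=
    (LinearMap.eqLocus φ.toLinearMap ((ContinuousMap.evalCLM ℂ p).toLinearMap ∘ₗ
      (akSubalgebra k).val.toLinearMap)).map (akSubalgebra k).val.toLinearMap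
  have hN : IsClosed (N : Set C(Bidisk, ℂ)) :=
    hclosed.isClosedEmbedding_subtypeVal.isClosedMap _ <|
      isClosed_eq hcont ((continuous_eval_const p).comp continuous_subtype_val)
  have hspan : Submodule.span ℂ (bidiskMonomials k : Set C(Bidisk, ℂ)) ≤ N := by
    refine Submodule.span_le.2 ?_
    rintro _ ⟨m, n, h, rfl⟩
    refine ⟨⟨_, bidiskMonomial_mem_akSubalgebra h⟩, ?_, rfl⟩
    have := hp m n h
    simp only [h, dite_true] at this
    exact this
  have hf : (f : C(Bidisk, ℂ)) ∈ N := by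
    refine closure_minimal hspan hN ?_
    rw [← coe_akSubalgebra]
    exact f.2
  obtain ⟨g, hg, hgf⟩ := hf
  obtain rfl : g = f := Subtype.ext hgf
  exact hg

/-- every character (nonzero multiplicative linear functional, equivalently
a unital algebra homomorphism) of `A_k(𝔻²)` is evaluation at a point of the closed bidisk. -/
theorem stmt1 (k : ℕ) (hk : 1 ≤ k) (χ : C(Bidisk, ℂ) → ℂ)
    (hadd : ∀ f g : C(Bidisk, ℂ), memAk k f → memAk k g → χ (f + g) = χ f + χ g)
    (hsmul : ∀ (c : ℂ) (f : C(Bidisk, ℂ)), memAk k f → χ (c • f) = c * χ f)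
    (hmul : ∀ f g : C(Bidisk, ℂ), memAk k f → memAk k g → χ (f * g) = χ f * χ g)
    (hone : χ 1 = 1) :
    ∃ p : Bidisk, ∀ f : C(Bidisk, ℂ), memAk k f → χ f = f p := by
  have hA : ∀ f : akSubalgebra k, memAk k f := fun f => mem_akSubalgebra_iff.1 f.2
  let φ : akSubalgebra k →ₐ[ℂ] ℂ := AlgHom.ofLinearMap
    { toFun := fun f => χ f
      map_add' := fun f g => hadd f g (hA f) (hA g)
      map_smul' := fun c f => hsmul c f (hA f) }
    hone fun f g => hmul f g (hA f) (hA g)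
  obtain ⟨p, hp⟩ := exists_eq_eval_of_algHom hk φ
  exact ⟨p, fun f hf => hp ⟨f, mem_akSubalgebra_iff.2 hf⟩⟩
end
end

section
/- Let k ≥ 1 and let (λ, μ) be a point of the closed bidisk with (λ, μ) ≠ (0, 0). Then the evaluation map ψ_{λ,μ} : B_{k,2} → M_k(ℂ), ψ_{λ,μ}(F) = F(λ, μ) = (f_{ij}(λ, μ)), is a surjective unital ℂ-algebra homomorphism. -/
noncomputable section

/-- The point `(0,0)` of the closed bidisk. -/
def pt0 : Bidisk := ⟨(0, 0), by simp [Bidisk]⟩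

/-- Membership in `B_{k,2}`: a continuous `M_k(ℂ)`-valued function on the closed bidisk whose
`(i,j)` entry is given on the open bidisk by a power series whose coefficients `a m n` vanish
unless `m + n ≡ i - j (mod k)`. -/
def memBk2 (k : ℕ) (F : C(Bidisk, Matrix (Fin k) (Fin k) ℂ)) : Prop :=
  ∀ i j : Fin k, ∃ a : ℕ → ℕ → ℂ,
    HasCoeffsAt (fun p => F p i j) a ∧
    ∀ m n : ℕ, ¬ Int.ModEq (k : ℤ) ((m : ℤ) + (n : ℤ)) ((i : ℤ) - (j : ℤ)) → a m n = 0

/-- The monomial `c z ^ r w ^ s` has a single nonzero coefficient. -/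
theorem hasCoeffsAt_monomial (c : ℂ) (r s : ℕ) :
    HasCoeffsAt (fun q => c * (q : ℂ × ℂ).1 ^ r * (q : ℂ × ℂ).2 ^ s)
      (fun m n => if m = r ∧ n = s then c else 0) := by
  intro q _ _
  convert hasSum_single (r, s) ?_ using 1
  · simp
  · rintro ⟨m, n⟩ h
    have h' : ¬ (m = r ∧ n = s) := fun ⟨h₁, h₂⟩ => h (by rw [h₁, h₂])
    simp [h']

/-- At a point other than the origin, some monomial of each degree does not vanish. -/
theorem exists_monomial_ne_zero {x : ℂ × ℂ} (hx : x ≠ 0) (e : ℕ) :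
    ∃ r s : ℕ, r + s = e ∧ x.1 ^ r * x.2 ^ s ≠ 0 := by
  by_cases h : x.1 = 0
  · have h₂ : x.2 ≠ 0 := fun h' => hx (Prod.ext h h')
    exact ⟨0, e, by simp, by simp [h₂]⟩
  · exact ⟨e, 0, by simp, by simp [h]⟩

/-- Each matrix is the value, at a given point other than the origin, of an element of `B_{k,2}`
whose entries are monomials. -/
theorem exists_memBk2_apply_eq {k : ℕ} (hk : 1 ≤ k) {p : Bidisk} (hp : (p : ℂ × ℂ) ≠ 0)
    (A : Matrix (Fin k) (Fin k) ℂ) :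
    ∃ F : C(Bidisk, Matrix (Fin k) (Fin k) ℂ), memBk2 k F ∧ F p = A := by
  choose r s hrs hne using fun i j : Fin k =>
    exists_monomial_ne_zero hp (((i : ℤ) - (j : ℤ)) % (k : ℤ)).toNat
  let c : Fin k → Fin k → ℂ := fun i j =>
    A i j / ((p : ℂ × ℂ).1 ^ r i j * (p : ℂ × ℂ).2 ^ s i j)
  refine ⟨⟨fun q => Matrix.of fun i j =>
    c i j * (q : ℂ × ℂ).1 ^ r i j * (q : ℂ × ℂ).2 ^ s i j, ?_⟩, fun i j => ?_, ?_⟩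
  · exact continuous_matrix fun i j => by
      simp only [Matrix.of_apply]
      fun_prop
  · refine ⟨_, hasCoeffsAt_monomial (c i j) (r i j) (s i j), fun m n hmn => if_neg ?_⟩
    rintro ⟨rfl, rfl⟩
    apply hmn
    have hpos : (0 : ℤ) ≤ ((i : ℤ) - (j : ℤ)) % (k : ℤ) := Int.emod_nonneg _ (by omega)
    rw [← Nat.cast_add, hrs, Int.toNat_of_nonneg hpos]
    exact Int.mod_modEq _ _
  · ext i j
    simp only [ContinuousMap.coe_mk, Matrix.of_apply, c]
    rw [mul_assoc, div_mul_cancel₀ _ (hne i j)]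

/-- for `(λ,μ) ≠ (0,0)` in the closed bidisk, the evaluation map
`ψ_{λ,μ} : B_{k,2} → M_k(ℂ)`, `F ↦ F(λ,μ)`, is a surjective unital `ℂ`-algebra
homomorphism. -/
theorem stmt7 (k : ℕ) (hk : 1 ≤ k) (p : Bidisk) (hp : (p : ℂ × ℂ) ≠ 0) :
    ((1 : C(Bidisk, Matrix (Fin k) (Fin k) ℂ)) p = 1) ∧
    (∀ F G : C(Bidisk, Matrix (Fin k) (Fin k) ℂ), memBk2 k F → memBk2 k G →
      (F + G) p = F p + G p) ∧
    (∀ (c : ℂ) (F : C(Bidisk, Matrix (Fin k) (Fin k) ℂ)), memBk2 k F →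
      (c • F) p = c • F p) ∧
    (∀ F G : C(Bidisk, Matrix (Fin k) (Fin k) ℂ), memBk2 k F → memBk2 k G →
      (F * G) p = F p * G p) ∧
    (∀ A : Matrix (Fin k) (Fin k) ℂ,
      ∃ F : C(Bidisk, Matrix (Fin k) (Fin k) ℂ), memBk2 k F ∧ F p = A) := by
  exact ⟨rfl, fun _ _ _ _ => rfl, fun _ _ _ => rfl, fun _ _ _ _ => rfl,
    exists_memBk2_apply_eq hk hp⟩
end
end

section
/- Let k ≥ 1 and let J be a maximal proper two-sided ideal of B_{k,2}. Then either J = ker ψ_{λ,μ} for some point (λ, μ) ≠ (0, 0) of the closed bidisk, where ψ_{λ,μ}(F) = F(λ, μ) ∈ M_k(ℂ), or J = ker ψ₀^ℓ for some ℓ ∈ {0, …, k−1}, where ψ₀^ℓ(F) = f_{ℓℓ}(0,0) ∈ ℂ. -/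
noncomputable section

/-- `J` is a two-sided ideal of the subring of `R` with carrier set `S`. -/
def IsIdealIn {R : Type*} [Ring R] (S J : Set R) : Prop :=
  J ⊆ S ∧ (0 : R) ∈ J ∧ (∀ f ∈ J, ∀ g ∈ J, f + g ∈ J) ∧ (∀ f ∈ J, -f ∈ J) ∧
    ∀ f ∈ S, ∀ g ∈ J, f * g ∈ J ∧ g * f ∈ J

/-- `J` is a maximal proper two-sided ideal of the subring of `R` with carrier set `S`. -/
def IsMaxIdealIn {R : Type*} [Ring R] (S J : Set R) : Prop :=
  IsIdealIn S J ∧ J ≠ S ∧ ∀ J' : Set R, IsIdealIn S J' → J ⊆ J' → J' = J ∨ J' = S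

namespace BidiskAlgebra

open MeasureTheory Filter Topology

lemma mem_iff (p : ℂ × ℂ) : p ∈ Bidisk ↔ ‖p.1‖ ≤ 1 ∧ ‖p.2‖ ≤ 1 := by
  simp [Bidisk]

/-- The first coordinate function on the closed bidisk. -/
def coordZ : C(Bidisk, ℂ) := ⟨fun p => (p : ℂ × ℂ).1, by fun_prop⟩

/-- The second coordinate function on the closed bidisk. -/
def coordW : C(Bidisk, ℂ) := ⟨fun p => (p : ℂ × ℂ).2, by fun_prop⟩

/-- The monomial `z ^ m * w ^ n` on the closed bidisk. -/
def mono (m n : ℕ) : C(Bidisk, ℂ) := coordZ ^ m * coordW ^ n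

lemma mono_apply (m n : ℕ) (p : Bidisk) :
    mono m n p = (p : ℂ × ℂ).1 ^ m * (p : ℂ × ℂ).2 ^ n := rfl

lemma norm_mono_le (m n : ℕ) : ‖mono m n‖ ≤ 1 := by
  refine (ContinuousMap.norm_le _ zero_le_one).2 fun p => ?_
  have hp := (mem_iff p).1 p.2
  rw [mono_apply, norm_mul, norm_pow, norm_pow]
  exact mul_le_one₀ (pow_le_one₀ (norm_nonneg _) hp.1) (by positivity)
    (pow_le_one₀ (norm_nonneg _) hp.2)

/-- The bidisk algebra, as the closure of the polynomials in the two coordinates. -/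
def bidiskAlgebra : Subalgebra ℂ C(Bidisk, ℂ) :=
  (Algebra.adjoin ℂ {coordZ, coordW}).topologicalClosure

lemma isClosed_bidiskAlgebra : IsClosed (bidiskAlgebra : Set C(Bidisk, ℂ)) :=
  Subalgebra.isClosed_topologicalClosure _

lemma coordZ_mem : coordZ ∈ bidiskAlgebra :=
  Subalgebra.le_topologicalClosure _ (Algebra.subset_adjoin (by simp))

lemma coordW_mem : coordW ∈ bidiskAlgebra :=
  Subalgebra.le_topologicalClosure _ (Algebra.subset_adjoin (by simp))

lemma mono_mem (m n : ℕ) : mono m n ∈ bidiskAlgebra :=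
  mul_mem (pow_mem coordZ_mem m) (pow_mem coordW_mem n)

/-- A closed subspace containing all monomials contains the bidisk algebra. -/
lemma mem_of_mono_mem {P : Submodule ℂ C(Bidisk, ℂ)} (hP : IsClosed (P : Set C(Bidisk, ℂ)))
    (h : ∀ m n, mono m n ∈ P) {f : C(Bidisk, ℂ)} (hf : f ∈ bidiskAlgebra) : f ∈ P := by
  have hsub : (Algebra.adjoin ℂ {coordZ, coordW} : Set C(Bidisk, ℂ)) ⊆ P := by
    intro g hg
    rw [SetLike.mem_coe, ← Subalgebra.mem_toSubmodule, Algebra.adjoin_eq_span] at hg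
    refine (Submodule.span_le.2 fun x hx => ?_) hg
    obtain ⟨m, n, rfl⟩ := (Submonoid.mem_closure_pair _ _ _).1 hx
    exact h m n
  exact closure_minimal hsub hP hf

/-- Two continuous linear maps agreeing on monomials agree on the bidisk algebra. -/
lemma eqOn_bidiskAlgebra {E : Type*} [TopologicalSpace E] [T2Space E] [AddCommMonoid E]
    [Module ℂ E] {L₁ L₂ : C(Bidisk, ℂ) →L[ℂ] E}
    (h : ∀ m n, L₁ (mono m n) = L₂ (mono m n)) {f : C(Bidisk, ℂ)} (hf : f ∈ bidiskAlgebra) :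
    L₁ f = L₂ f :=
  mem_of_mono_mem (P := LinearMap.eqLocus (L₁ : C(Bidisk, ℂ) →ₗ[ℂ] E) (L₂ : C(Bidisk, ℂ) →ₗ[ℂ] E))
    (isClosed_eq L₁.continuous L₂.continuous) h hf

/-- The contraction `(z, w) ↦ (c z, c w)` of the closed bidisk. -/
def scale (c : ℂ) (hc : ‖c‖ ≤ 1) : C(Bidisk, Bidisk) where
  toFun p := ⟨(c * (p : ℂ × ℂ).1, c * (p : ℂ × ℂ).2), by
    have hp := (mem_iff p).1 p.2
    rw [mem_iff]
    simp only [norm_mul]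
    exact ⟨mul_le_one₀ hc (norm_nonneg _) hp.1, mul_le_one₀ hc (norm_nonneg _) hp.2⟩⟩
  continuous_toFun := by fun_prop

lemma mono_scale (c : ℂ) (hc : ‖c‖ ≤ 1) (m n : ℕ) (p : Bidisk) :
    mono m n (scale c hc p) = c ^ (m + n) * mono m n p := by
  simp only [mono_apply, scale, ContinuousMap.coe_mk, mul_pow, pow_add]
  ring

/-- Composition with a contraction, as a continuous linear map. -/
def scaleL (c : ℂ) (hc : ‖c‖ ≤ 1) : C(Bidisk, ℂ) →L[ℂ] C(Bidisk, ℂ) where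
  toFun f := f.comp (scale c hc)
  map_add' _ _ := rfl
  map_smul' _ _ := rfl
  cont := ContinuousMap.continuous_precomp _

lemma scaleL_apply (c : ℂ) (hc : ‖c‖ ≤ 1) (f : C(Bidisk, ℂ)) (p : Bidisk) :
    scaleL c hc f p = f (scale c hc p) := rfl

lemma scaleL_mono (c : ℂ) (hc : ‖c‖ ≤ 1) (m n : ℕ) :
    scaleL c hc (mono m n) = c ^ (m + n) • mono m n := by
  ext p
  exact mono_scale c hc m n p

instance : Fact ((0 : ℝ) < 1) := ⟨one_pos⟩

/-- The point of the distinguished boundary with given angles. -/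
def torusPoint (x : AddCircle (1 : ℝ) × AddCircle (1 : ℝ)) : Bidisk :=
  ⟨(fourier 1 x.1, fourier 1 x.2), by
    rw [mem_iff]; exact ⟨(Circle.norm_coe _).le, (Circle.norm_coe _).le⟩⟩

lemma continuous_torusPoint : Continuous torusPoint := by
  unfold torusPoint
  fun_prop

/-- Normalized Haar measure on the torus. -/
abbrev torusMeasure : Measure (AddCircle (1 : ℝ) × AddCircle (1 : ℝ)) :=
  AddCircle.haarAddCircle.prod AddCircle.haarAddCircle

lemma integral_fourier_mul_fourier (m n : ℤ) :
    ∫ x : AddCircle (1 : ℝ), fourier m x * fourier (-n) x ∂AddCircle.haarAddCircle =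
      if m = n then 1 else 0 := by
  have h := (orthonormal_iff_ite.1 (orthonormal_fourier (T := 1))) n m
  rw [ContinuousMap.inner_toLp AddCircle.haarAddCircle (fourier n) (fourier m)] at h
  simp only [fourier_neg]
  rw [h]
  simp [eq_comm]

lemma fourier_one_pow (m : ℕ) (x : AddCircle (1 : ℝ)) :
    fourier 1 x ^ m = fourier (m : ℤ) x := by
  induction m with
  | zero => simp
  | succ m ih => rw [pow_succ, ih]; push_cast; rw [fourier_add]

lemma norm_fourier_apply (n : ℤ) (x : AddCircle (1 : ℝ)) : ‖fourier n x‖ = 1 :=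
  Circle.norm_coe _

/-- The integrand defining the Fourier coefficients of a function on the closed bidisk. -/
def coeffIntegrand (m n : ℕ) (f : C(Bidisk, ℂ)) (x : AddCircle (1 : ℝ) × AddCircle (1 : ℝ)) : ℂ :=
  f (torusPoint x) * (fourier (-(m : ℤ)) x.1 * fourier (-(n : ℤ)) x.2)

lemma integrable_coeffIntegrand (m n : ℕ) (f : C(Bidisk, ℂ)) :
    Integrable (coeffIntegrand m n f) torusMeasure := by
  have hc : Continuous (coeffIntegrand m n f) := by
    have := continuous_torusPoint
    unfold coeffIntegrand
    fun_prop
  exact hc.integrable_of_hasCompactSupport (HasCompactSupport.of_compactSpace _)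

/-- The `(m, n)` Fourier coefficient of the restriction to the distinguished boundary. -/
def coeffL (m n : ℕ) : C(Bidisk, ℂ) →L[ℂ] ℂ :=
  LinearMap.mkContinuous
    { toFun := fun f => ∫ x, coeffIntegrand m n f x ∂torusMeasure
      map_add' := fun f g => by
        rw [← integral_add (integrable_coeffIntegrand m n f) (integrable_coeffIntegrand m n g)]
        simp [coeffIntegrand, add_mul]
      map_smul' := fun c f => by
        rw [RingHom.id_apply, smul_eq_mul, ← integral_const_mul]
        simp [coeffIntegrand, mul_assoc] } 1 fun f => by
    have h := norm_integral_le_of_norm_le_const (μ := torusMeasure)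
      (f := coeffIntegrand m n f) (C := ‖f‖) (ae_of_all _ fun x => by
        rw [coeffIntegrand, norm_mul, norm_mul, norm_fourier_apply, norm_fourier_apply]
        simpa using f.norm_coe_le_norm (torusPoint x))
    simpa using h

lemma norm_coeffL_le (m n : ℕ) : ‖coeffL m n‖ ≤ 1 :=
  LinearMap.mkContinuous_norm_le _ zero_le_one _

lemma coeffL_mono (m n a b : ℕ) :
    coeffL m n (mono a b) = (if a = m then 1 else 0) * (if b = n then 1 else 0) := by
  have h : ∀ x, coeffIntegrand m n (mono a b) x =
      (fourier (a : ℤ) x.1 * fourier (-(m : ℤ)) x.1) *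
        (fourier (b : ℤ) x.2 * fourier (-(n : ℤ)) x.2) := fun x => by
    rw [coeffIntegrand, mono_apply]
    simp only [torusPoint, fourier_one_pow]
    ring
  change ∫ x, coeffIntegrand m n (mono a b) x ∂torusMeasure = _
  simp_rw [h]
  rw [integral_prod_mul (f := fun x => fourier (a : ℤ) x * fourier (-(m : ℤ)) x)
    (g := fun x => fourier (b : ℤ) x * fourier (-(n : ℤ)) x),
    integral_fourier_mul_fourier, integral_fourier_mul_fourier]
  simp

lemma hasSum_smul_apply {ι E : Type*} [NormedAddCommGroup E] [NormedSpace ℂ E] {c : ι → ℂ}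
    {L : ι → E →L[ℂ] ℂ} {S : E →L[ℂ] ℂ} (h : HasSum (fun q => c q • L q) S) (x : E) :
    HasSum (fun q => c q * L q x) (S x) := by
  have := (ContinuousLinearMap.apply ℂ ℂ x).hasSum h
  exact this

/-- Every element of the bidisk algebra is the sum of its power series on the open bidisk. -/
lemma hasCoeffsAt_coeffL {f : C(Bidisk, ℂ)} (hf : f ∈ bidiskAlgebra) :
    HasCoeffsAt f fun m n => coeffL m n f := by
  intro p hz hw
  set z := (p : ℂ × ℂ).1
  set w := (p : ℂ × ℂ).2
  have hbound : Summable fun q : ℕ × ℕ => ‖z‖ ^ q.1 * ‖w‖ ^ q.2 :=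
    (summable_geometric_of_lt_one (norm_nonneg _) hz).mul_of_nonneg
      (summable_geometric_of_lt_one (norm_nonneg _) hw) (fun _ => by positivity)
      (fun _ => by positivity)
  obtain ⟨S, hS⟩ : Summable fun q : ℕ × ℕ => (z ^ q.1 * w ^ q.2) • coeffL q.1 q.2 := by
    refine Summable.of_norm_bounded hbound fun q => ?_
    rw [norm_smul, norm_mul, norm_pow, norm_pow]
    exact mul_le_of_le_one_right (by positivity) (norm_coeffL_le _ _)
  have happ : ∀ g : C(Bidisk, ℂ),
      HasSum (fun q : ℕ × ℕ => (z ^ q.1 * w ^ q.2) * coeffL q.1 q.2 g) (S g) := fun g =>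
    hasSum_smul_apply hS g
  have key : S f = ContinuousMap.evalCLM ℂ p f := by
    refine eqOn_bidiskAlgebra (fun a b => ?_) hf
    refine (happ (mono a b)).unique ?_
    have h := hasSum_single (f := fun q : ℕ × ℕ => z ^ q.1 * w ^ q.2 *
        coeffL q.1 q.2 (mono a b)) (a, b) fun q hq => by
      have hne : ¬(a = q.1 ∧ b = q.2) := fun h => hq (Prod.ext h.1.symm h.2.symm)
      rw [coeffL_mono]
      rcases not_and_or.1 hne with h | h <;> simp [h]
    dsimp only at h
    rwa [coeffL_mono, if_pos rfl, if_pos rfl, mul_one, mul_one] at h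
  have h := happ f
  rw [key] at h
  have hcomm : (fun q : ℕ × ℕ => z ^ q.1 * w ^ q.2 * coeffL q.1 q.2 f) =
      fun q : ℕ × ℕ => coeffL q.1 q.2 f * z ^ q.1 * w ^ q.2 := by
    funext q
    ring
  rw [hcomm] at h
  exact h

/-- A function with a power series expansion on the open bidisk lies in every closed subspace
containing the monomials that occur in its expansion. -/
lemma mem_of_hasCoeffsAt {f : C(Bidisk, ℂ)} {a : ℕ → ℕ → ℂ} (hf : HasCoeffsAt f a)
    (P : Submodule ℂ C(Bidisk, ℂ)) (hP : IsClosed (P : Set C(Bidisk, ℂ)))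
    (hmono : ∀ m n, a m n ≠ 0 → mono m n ∈ P) : f ∈ P := by
  have hr : ∀ (r : unitInterval), ‖((r : ℝ) : ℂ)‖ ≤ 1 := fun r => by
    simpa [abs_of_nonneg r.2.1] using r.2.2
  have hmem : ∀ r : unitInterval, (r : ℝ) < 1 → scaleL ((r : ℝ) : ℂ) (hr r) f ∈ P := by
    intro r hr1
    have hn : ‖((r : ℝ) : ℂ)‖ < 1 := by simpa [abs_of_nonneg r.2.1] using hr1
    let T : ℕ × ℕ → C(Bidisk, ℂ) := fun q =>
      (a q.1 q.2 * ((r : ℝ) : ℂ) ^ q.1 * ((r : ℝ) : ℂ) ^ q.2) • mono q.1 q.2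
    have hT : Summable T := by
      have h := (hf ⟨(((r : ℝ) : ℂ), ((r : ℝ) : ℂ)), by rw [mem_iff]; exact ⟨hr r, hr r⟩⟩
        hn hn).summable.norm
      refine Summable.of_norm_bounded h fun q => ?_
      rw [norm_smul]
      exact mul_le_of_le_one_right (norm_nonneg _) (norm_mono_le _ _)
    have hsum : ∑' q, T q = scaleL ((r : ℝ) : ℂ) (hr r) f := by
      ext p
      have h1 := (ContinuousMap.evalCLM ℂ p).hasSum hT.hasSum
      have hp := (mem_iff p).1 p.2
      refine h1.unique ?_
      have h2 := hf (scale ((r : ℝ) : ℂ) (hr r) p)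
        (by
          simp only [scale, ContinuousMap.coe_mk, norm_mul]
          exact mul_lt_one_of_nonneg_of_lt_one_left (norm_nonneg _) hn hp.1)
        (by
          simp only [scale, ContinuousMap.coe_mk, norm_mul]
          exact mul_lt_one_of_nonneg_of_lt_one_left (norm_nonneg _) hn hp.2)
      rw [scaleL_apply]
      refine h2.congr_fun fun q => ?_
      simp only [T, scale, ContinuousMap.evalCLM_apply, ContinuousMap.coe_mk,
        ContinuousMap.smul_apply, smul_eq_mul,
        mono_apply, mul_pow]
      ring
    rw [← hsum]
    refine hP.mem_of_tendsto hT.hasSum (Eventually.of_forall fun s => P.sum_mem fun q _ => ?_)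
    by_cases h : a q.1 q.2 = 0
    · simp [T, h]
    · exact P.smul_mem _ (hmono _ _ h)
  let H : C(unitInterval × Bidisk, ℂ) :=
    ⟨fun x => f (scale ((x.1 : ℝ) : ℂ) (hr x.1) x.2), f.continuous.comp
      (Continuous.subtype_mk (by fun_prop) _)⟩
  have hcont : Continuous fun r : unitInterval => scaleL ((r : ℝ) : ℂ) (hr r) f :=
    H.curry.continuous
  have h1 : scaleL (((1 : unitInterval) : ℝ) : ℂ) (hr 1) f = f := by
    ext p
    simp [scaleL_apply, scale]
  have hdense : (1 : unitInterval) ∈ closure {r : unitInterval | (r : ℝ) < 1} := by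
    have hs : Tendsto (fun n : ℕ => (⟨1 - ((n : ℝ) + 1)⁻¹, by
        constructor
        · rw [sub_nonneg]; exact inv_le_one_of_one_le₀ (by simp)
        · rw [sub_le_self_iff]; positivity⟩ : unitInterval)) atTop (𝓝 1) := by
      rw [tendsto_subtype_rng]
      have := tendsto_one_div_add_atTop_nhds_zero_nat (𝕜 := ℝ)
      simpa using this.const_sub 1
    refine mem_closure_of_tendsto hs (Eventually.of_forall fun n => ?_)
    simp only [Set.mem_ofPred_eq, sub_lt_self_iff]
    positivity
  have := map_mem_closure hcont hdense (t := (P : Set C(Bidisk, ℂ))) fun r hr1 => hmem r hr1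
  rwa [h1, hP.closure_eq] at this

lemma scaleL_mem (c : ℂ) (hc : ‖c‖ ≤ 1) {f : C(Bidisk, ℂ)} (hf : f ∈ bidiskAlgebra) :
    scaleL c hc f ∈ bidiskAlgebra :=
  mem_of_mono_mem
    (P := (Subalgebra.toSubmodule bidiskAlgebra).comap
      (scaleL c hc : C(Bidisk, ℂ) →ₗ[ℂ] C(Bidisk, ℂ)))
    (isClosed_bidiskAlgebra.preimage (scaleL c hc).continuous)
    (fun m n => by
      change scaleL c hc (mono m n) ∈ bidiskAlgebra
      rw [scaleL_mono]
      exact Subalgebra.smul_mem _ (mono_mem m n) _) hf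

section Homogeneous

variable (k : ℕ)

/-- The standard primitive `k`-th root of unity. -/
def omega : ℂ := Complex.exp (2 * Real.pi * Complex.I / k)

lemma omega_ne_zero : omega k ≠ 0 := Complex.exp_ne_zero _

lemma norm_omega : ‖omega k‖ = 1 := by
  have h : (2 * Real.pi * Complex.I / k : ℂ) = ((2 * Real.pi / k : ℝ) : ℂ) * Complex.I := by
    push_cast
    ring
  rw [omega, h, Complex.norm_exp_ofReal_mul_I]

/-- The rotation operator `f ↦ f (ω z, ω w)`. -/
def rotL : C(Bidisk, ℂ) →L[ℂ] C(Bidisk, ℂ) := scaleL (omega k) (norm_omega k).le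

lemma rotL_mul (f g : C(Bidisk, ℂ)) : rotL k (f * g) = rotL k f * rotL k g := rfl

lemma rotL_mono (m n : ℕ) : rotL k (mono m n) = omega k ^ (m + n) • mono m n :=
  scaleL_mono _ _ m n

/-- The elements of the bidisk algebra that are homogeneous of degree `d` modulo `k`. -/
def homog (d : ℤ) : Submodule ℂ C(Bidisk, ℂ) :=
  Subalgebra.toSubmodule bidiskAlgebra ⊓
    LinearMap.eqLocus (rotL k : C(Bidisk, ℂ) →ₗ[ℂ] C(Bidisk, ℂ))
      (omega k ^ d • LinearMap.id)

variable {k}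

lemma mem_homog {d : ℤ} {f : C(Bidisk, ℂ)} :
    f ∈ homog k d ↔ f ∈ bidiskAlgebra ∧ rotL k f = omega k ^ d • f := Iff.rfl

lemma isClosed_homog (d : ℤ) : IsClosed (homog k d : Set C(Bidisk, ℂ)) :=
  isClosed_bidiskAlgebra.inter
    (isClosed_eq (rotL k).continuous (continuous_const_smul (omega k ^ d)))

lemma mul_mem_homog {d e : ℤ} {f g : C(Bidisk, ℂ)} (hf : f ∈ homog k d) (hg : g ∈ homog k e) :
    f * g ∈ homog k (d + e) := by
  rw [mem_homog] at *
  refine ⟨mul_mem hf.1 hg.1, ?_⟩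
  rw [rotL_mul, hf.2, hg.2, smul_mul_smul_comm, zpow_add₀ (omega_ne_zero k)]

lemma one_mem_homog : (1 : C(Bidisk, ℂ)) ∈ homog k 0 :=
  mem_homog.2 ⟨one_mem _, by rw [zpow_zero, one_smul]; rfl⟩

lemma isPrimitiveRoot_omega (hk : 1 ≤ k) : IsPrimitiveRoot (omega k) k :=
  Complex.isPrimitiveRoot_exp k (by omega)

lemma omega_pow_eq_iff (hk : 1 ≤ k) (n : ℕ) (d : ℤ) :
    omega k ^ n = omega k ^ d ↔ (n : ℤ) ≡ d [ZMOD k] := by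
  rw [← zpow_natCast, ← div_eq_one_iff_eq (zpow_ne_zero _ (omega_ne_zero k)),
    ← zpow_sub₀ (omega_ne_zero k),
    (isPrimitiveRoot_omega hk).zpow_eq_one_iff_dvd, Int.modEq_comm,
    Int.modEq_iff_dvd]

lemma mono_mem_homog (hk : 1 ≤ k) {m n : ℕ} {d : ℤ} (h : (m : ℤ) + n ≡ d [ZMOD k]) :
    mono m n ∈ homog k d := by
  refine mem_homog.2 ⟨mono_mem m n, ?_⟩
  rw [rotL_mono, (omega_pow_eq_iff hk (m + n) d).2 (by exact_mod_cast h)]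

/-- Homogeneity modulo `k` in terms of power series coefficients. -/
lemma mem_homog_iff (hk : 1 ≤ k) {d : ℤ} {f : C(Bidisk, ℂ)} :
    f ∈ homog k d ↔ ∃ a : ℕ → ℕ → ℂ, HasCoeffsAt f a ∧
      ∀ m n : ℕ, ¬ (m : ℤ) + n ≡ d [ZMOD k] → a m n = 0 := by
  constructor
  · intro hf
    rw [mem_homog] at hf
    refine ⟨_, hasCoeffsAt_coeffL hf.1, fun m n hmn => ?_⟩
    have h : coeffL m n (rotL k f) = omega k ^ (m + n) * coeffL m n f := by
      refine eqOn_bidiskAlgebra (L₁ := (coeffL m n).comp (rotL k))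
        (L₂ := omega k ^ (m + n) • coeffL m n) (fun a b => ?_) hf.1
      change coeffL m n (rotL k (mono a b)) = omega k ^ (m + n) * coeffL m n (mono a b)
      rw [rotL_mono, map_smul, coeffL_mono, smul_eq_mul]
      by_cases ha : a = m
      · by_cases hb : b = n
        · rw [ha, hb]
        · simp [hb]
      · simp [ha]
    rw [hf.2, map_smul, smul_eq_mul] at h
    by_contra hne
    exact hmn (by exact_mod_cast (omega_pow_eq_iff hk (m + n) d).1 (mul_right_cancel₀ hne h).symm)
  · rintro ⟨a, ha, hd⟩
    refine mem_of_hasCoeffsAt ha _ (isClosed_homog d) fun m n hmn => mono_mem_homog hk ?_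
    by_contra h
    exact hmn (hd m n h)

lemma exists_homog_apply_ne_zero (hk : 1 ≤ k) {p : Bidisk} (hp : (p : ℂ × ℂ) ≠ 0) (d : ℤ) :
    ∃ f ∈ homog k d, f p ≠ 0 := by
  have hk0 : (k : ℤ) ≠ 0 := by omega
  have hcast : (((d % k).toNat : ℕ) : ℤ) ≡ d [ZMOD k] := by
    rw [Int.toNat_of_nonneg (Int.emod_nonneg _ hk0)]
    exact Int.mod_modEq d k
  by_cases hz : (p : ℂ × ℂ).1 = 0
  · have hw : (p : ℂ × ℂ).2 ≠ 0 := fun hw => hp (Prod.ext hz hw)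
    exact ⟨mono 0 (d % k).toNat, mono_mem_homog hk (by simpa using hcast),
      by simp [mono_apply, hw]⟩
  · exact ⟨mono (d % k).toNat 0, mono_mem_homog hk (by simpa using hcast),
      by simp [mono_apply, hz]⟩

lemma rotL_pow_mem (j : ℕ) {f : C(Bidisk, ℂ)} (hf : f ∈ bidiskAlgebra) :
    (rotL k ^ j) f ∈ bidiskAlgebra := by
  induction j with
  | zero => exact hf
  | succ j ih =>
    rw [pow_succ']
    exact scaleL_mem _ _ ih

lemma rotL_pow_mono (j m n : ℕ) :
    (rotL k ^ j) (mono m n) = (omega k ^ (m + n)) ^ j • mono m n := by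
  induction j with
  | zero => simp
  | succ j ih =>
    rw [pow_succ']
    change rotL k ((rotL k ^ j) (mono m n)) = _
    rw [ih, map_smul, rotL_mono, smul_smul, ← pow_succ]

lemma rotL_pow_card (hk : 1 ≤ k) {f : C(Bidisk, ℂ)} (hf : f ∈ bidiskAlgebra) :
    (rotL k ^ k) f = f := by
  refine eqOn_bidiskAlgebra (L₁ := rotL k ^ k) (L₂ := ContinuousLinearMap.id ℂ _)
    (fun m n => ?_) hf
  have h : omega k ^ k = 1 := (isPrimitiveRoot_omega hk).pow_eq_one
  rw [rotL_pow_mono, ← pow_mul, mul_comm, pow_mul, h, one_pow, one_smul]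
  rfl

lemma rotL_pow_mul_of_mem (j : ℕ) (g : C(Bidisk, ℂ)) {f : C(Bidisk, ℂ)} (hf : f ∈ homog k 0) :
    (rotL k ^ j) (g * f) = (rotL k ^ j) g * f := by
  have hf' : rotL k f = f := by simpa using (mem_homog.1 hf).2
  induction j with
  | zero => rfl
  | succ j ih =>
    rw [pow_succ']
    change rotL k ((rotL k ^ j) (g * f)) = rotL k ((rotL k ^ j) g) * f
    rw [ih, rotL_mul, hf']

variable (k) in
/-- The averaging projection onto the functions invariant under rotation. -/
def avg : C(Bidisk, ℂ) →L[ℂ] C(Bidisk, ℂ) := (k : ℂ)⁻¹ • ∑ j ∈ Finset.range k, rotL k ^ j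

lemma avg_apply (f : C(Bidisk, ℂ)) :
    avg k f = (k : ℂ)⁻¹ • ∑ j ∈ Finset.range k, (rotL k ^ j) f := by
  simp [avg]

lemma avg_mem (hk : 1 ≤ k) {f : C(Bidisk, ℂ)} (hf : f ∈ bidiskAlgebra) : avg k f ∈ homog k 0 := by
  rw [avg_apply]
  refine Submodule.smul_mem _ _ (mem_homog.2 ⟨sum_mem fun j _ => rotL_pow_mem j hf, ?_⟩)
  rw [zpow_zero, one_smul, map_sum]
  have h : ∀ j, rotL k ((rotL k ^ j) f) = (rotL k ^ (j + 1)) f := fun j => by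
    rw [pow_succ']
    rfl
  have h1 := Finset.sum_range_succ (fun j => (rotL k ^ j) f) k
  rw [Finset.sum_range_succ', rotL_pow_card hk hf, pow_zero] at h1
  simp_rw [h]
  exact add_right_cancel h1

lemma avg_mul_of_mem (g : C(Bidisk, ℂ)) {f : C(Bidisk, ℂ)} (hf : f ∈ homog k 0) :
    avg k (g * f) = avg k g * f := by
  rw [avg_apply, avg_apply, smul_mul_assoc, Finset.sum_mul]
  simp_rw [rotL_pow_mul_of_mem _ g hf]

lemma avg_one (hk : 1 ≤ k) : avg k 1 = 1 := by
  have h : ∀ j, (rotL k ^ j) 1 = 1 := fun j => by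
    have := rotL_pow_mono (k := k) j 0 0
    simpa [mono] using this
  have hk0 : (k : ℂ) ≠ 0 := by exact_mod_cast (by omega : k ≠ 0)
  rw [avg_apply]
  simp_rw [h]
  rw [Finset.sum_const, Finset.card_range, ← Nat.cast_smul_eq_nsmul ℂ, smul_smul,
    inv_mul_cancel₀ hk0, one_smul]

end Homogeneous

instance : Nonempty Bidisk := ⟨pt0⟩

instance : CompleteSpace bidiskAlgebra := isClosed_bidiskAlgebra.completeSpace_coe

lemma norm_one_bidiskAlgebra : ‖(1 : bidiskAlgebra)‖ = 1 :=
  (norm_one : ‖(1 : C(Bidisk, ℂ))‖ = 1)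

instance : NormOneClass bidiskAlgebra := ⟨norm_one_bidiskAlgebra⟩

lemma exists_algHom_of_isMaximal {A : Type*} [NormedCommRing A] [NormedAlgebra ℂ A]
    [CompleteSpace A] [NormOneClass A] (M : Ideal A) [M.IsMaximal] :
    ∃ φ : A →ₐ[ℂ] ℂ, (∀ a, ‖φ a‖ ≤ ‖a‖) ∧ ∀ a ∈ M, φ a = 0 :=
  ⟨WeakDual.CharacterSpace.toAlgHom M.toCharacterSpace,
    AlgHom.norm_apply_le_self (WeakDual.CharacterSpace.toAlgHom M.toCharacterSpace),
    fun _ ha => M.toCharacterSpace_apply_eq_zero_of_mem ha⟩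

/-- Every contractive character of the bidisk algebra is the evaluation at a point of the closed
bidisk. -/
lemma exists_character_eq_eval (φ : bidiskAlgebra →ₐ[ℂ] ℂ)
    (hnorm : ∀ f : bidiskAlgebra, ‖φ f‖ ≤ ‖(f : C(Bidisk, ℂ))‖) :
    ∃ p : Bidisk, ∀ f : bidiskAlgebra, φ f = (f : C(Bidisk, ℂ)) p := by
  let z : bidiskAlgebra := ⟨coordZ, coordZ_mem⟩
  let w : bidiskAlgebra := ⟨coordW, coordW_mem⟩
  have hz : ‖coordZ‖ ≤ 1 := by simpa [mono] using norm_mono_le 1 0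
  have hw : ‖coordW‖ ≤ 1 := by simpa [mono] using norm_mono_le 0 1
  let p : Bidisk := ⟨(φ z, φ w), (mem_iff _).2 ⟨(hnorm z).trans hz, (hnorm w).trans hw⟩⟩
  refine ⟨p, fun f => ?_⟩
  have hφ : Continuous φ := AddMonoidHomClass.continuous_of_bound φ 1 fun f => by
    rw [one_mul]
    exact hnorm f
  let E : Submodule ℂ bidiskAlgebra :=
    LinearMap.eqLocus φ.toLinearMap
      ((ContinuousMap.evalCLM (M := ℂ) ℂ p).toLinearMap ∘ₗ bidiskAlgebra.val.toLinearMap)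
  have hE : IsClosed (E : Set bidiskAlgebra) :=
    isClosed_eq hφ
      ((ContinuousMap.evalCLM ℂ p).continuous.comp continuous_subtype_val)
  have hP : IsClosed ((E.map bidiskAlgebra.val.toLinearMap :
      Submodule ℂ C(Bidisk, ℂ)) : Set C(Bidisk, ℂ)) :=
    isClosed_bidiskAlgebra.isClosedEmbedding_subtypeVal.isClosedMap _ hE
  obtain ⟨g, hg, hgf⟩ := mem_of_mono_mem hP (fun m n => ⟨z ^ m * w ^ n, by
    change φ (z ^ m * w ^ n) = _
    rw [map_mul, map_pow, map_pow]
    rfl, rfl⟩) f.2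
  obtain rfl : g = f := Subtype.ext hgf
  exact hg

/-- An ideal of the algebra of functions of degree `0` modulo `k` without common zeros is the
whole algebra. -/
lemma one_mem_of_no_common_zero {k : ℕ} (hk : 1 ≤ k) {I : Set C(Bidisk, ℂ)}
    (hI : ∀ f ∈ I, f ∈ homog k 0) (hzero : 0 ∈ I) (hadd : ∀ f ∈ I, ∀ g ∈ I, f + g ∈ I)
    (hmul : ∀ g ∈ homog k 0, ∀ f ∈ I, g * f ∈ I) (hne : ∀ p, ∃ f ∈ I, f p ≠ 0) : 1 ∈ I := by
  let K : Ideal bidiskAlgebra := Ideal.span {x | (x : C(Bidisk, ℂ)) ∈ I}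
  have hK : K = ⊤ := by
    by_contra hK
    obtain ⟨M, hM, hKM⟩ := K.exists_le_maximal hK
    obtain ⟨φ, hφ, hφM⟩ := exists_algHom_of_isMaximal M
    obtain ⟨p, hp⟩ := exists_character_eq_eval φ hφ
    obtain ⟨f, hf, hfp⟩ := hne p
    have h := hφM _
      (hKM (Ideal.subset_span (show (⟨f, (hI f hf).1⟩ : bidiskAlgebra) ∈ _ from hf)))
    rw [hp] at h
    exact hfp h
  have key : ∀ x ∈ K, ∀ g : bidiskAlgebra, avg k (g * x : bidiskAlgebra) ∈ I := by
    intro x hx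
    induction hx using Submodule.span_induction with
    | mem x hx =>
      intro g
      rw [Subalgebra.coe_mul, avg_mul_of_mem _ (hI _ hx)]
      exact hmul _ (avg_mem hk g.2) _ hx
    | zero =>
      intro g
      rw [mul_zero, Subalgebra.coe_zero, map_zero]
      exact hzero
    | add x y _ _ hx hy =>
      intro g
      rw [mul_add, Subalgebra.coe_add, map_add]
      exact hadd _ (hx g) _ (hy g)
    | smul a x _ hx =>
      intro g
      have h := hx (g * a)
      rwa [mul_assoc] at h
  have h := key 1 (hK ▸ Submodule.mem_top) 1
  rwa [mul_one, Subalgebra.coe_one, avg_one hk] at h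

section Matrices

variable {k : ℕ}

/-- The `(i, j)` entry of a matrix-valued function. -/
def entry (F : C(Bidisk, Matrix (Fin k) (Fin k) ℂ)) (i j : Fin k) : C(Bidisk, ℂ) :=
  ⟨fun p => F p i j, by fun_prop⟩

/-- The matrix-valued function with `f` in position `(i, j)` and zeros elsewhere. -/
def single (i j : Fin k) (f : C(Bidisk, ℂ)) : C(Bidisk, Matrix (Fin k) (Fin k) ℂ) :=
  ⟨fun p => Matrix.single i j (f p), by
    refine continuous_matrix fun a b => ?_
    simp only [Matrix.single_apply]
    split_ifs
    · exact f.continuous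
    · exact continuous_const⟩

lemma single_apply (i j : Fin k) (f : C(Bidisk, ℂ)) (p : Bidisk) :
    single i j f p = Matrix.single i j (f p) := rfl

lemma memBk2_iff (hk : 1 ≤ k) (F : C(Bidisk, Matrix (Fin k) (Fin k) ℂ)) :
    memBk2 k F ↔ ∀ i j : Fin k, entry F i j ∈ homog k ((i : ℤ) - (j : ℤ)) :=
  forall₂_congr fun i j => (mem_homog_iff hk (f := entry F i j)).symm

lemma memBk2_single (hk : 1 ≤ k) {i j : Fin k} {f : C(Bidisk, ℂ)}
    (hf : f ∈ homog k ((i : ℤ) - (j : ℤ))) : memBk2 k (single i j f) := by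
  refine (memBk2_iff hk _).2 fun a b => ?_
  by_cases h : i = a ∧ j = b
  · obtain ⟨rfl, rfl⟩ := h
    convert hf
    ext p
    simp [entry, single]
  · convert Submodule.zero_mem _
    ext p
    simp [entry, single, h]

lemma memBk2_mul (hk : 1 ≤ k) {F G : C(Bidisk, Matrix (Fin k) (Fin k) ℂ)} (hF : memBk2 k F)
    (hG : memBk2 k G) : memBk2 k (F * G) := by
  rw [memBk2_iff hk] at *
  intro i j
  have h : entry (F * G) i j = ∑ l, entry F i l * entry G l j := by
    ext p
    simp [entry, Matrix.mul_apply]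
  rw [h]
  refine sum_mem fun l _ => ?_
  have := mul_mem_homog (hF i l) (hG l j)
  rwa [sub_add_sub_cancel] at this

lemma memBk2_zero (hk : 1 ≤ k) : memBk2 k (0 : C(Bidisk, Matrix (Fin k) (Fin k) ℂ)) :=
  (memBk2_iff hk _).2 fun _ _ => Submodule.zero_mem _

lemma memBk2_add (hk : 1 ≤ k) {F G : C(Bidisk, Matrix (Fin k) (Fin k) ℂ)} (hF : memBk2 k F)
    (hG : memBk2 k G) : memBk2 k (F + G) := by
  rw [memBk2_iff hk] at *
  exact fun i j => add_mem (hF i j) (hG i j)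

lemma memBk2_neg (hk : 1 ≤ k) {F : C(Bidisk, Matrix (Fin k) (Fin k) ℂ)} (hF : memBk2 k F) :
    memBk2 k (-F) := by
  rw [memBk2_iff hk] at *
  exact fun i j => neg_mem (hF i j)

lemma sum_single_one : ∑ l : Fin k, single l l 1 = 1 := by
  ext p i j
  simp [single_apply, ContinuousMap.coe_sum, Matrix.sum_apply, Matrix.single_apply,
    Matrix.one_apply, ite_and]

lemma memBk2_one (hk : 1 ≤ k) : memBk2 k (1 : C(Bidisk, Matrix (Fin k) (Fin k) ℂ)) := by
  rw [← sum_single_one]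
  refine Finset.sum_induction _ _ (fun _ _ => memBk2_add hk) (memBk2_zero hk) fun l _ =>
    memBk2_single hk ?_
  rw [sub_self]
  exact one_mem_homog

lemma single_mul_mul_single (l i j : Fin k) (f g : C(Bidisk, ℂ))
    (F : C(Bidisk, Matrix (Fin k) (Fin k) ℂ)) :
    single l i f * F * single j l g = single l l (f * entry F i j * g) := by
  ext p a b
  simp [single_apply, entry]

/-- The off-diagonal entries of an element of the algebra vanish at the origin. -/
lemma apply_pt0_eq_zero {F : C(Bidisk, Matrix (Fin k) (Fin k) ℂ)}
    (hF : memBk2 k F) {i j : Fin k} (hij : i ≠ j) : F pt0 i j = 0 := by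
  obtain ⟨a, ha, hd⟩ := hF i j
  have h := ha pt0 (by simp [pt0]) (by simp [pt0])
  refine h.unique ?_
  convert hasSum_zero with q
  by_cases hq : q = (0, 0)
  · rw [hq, hd 0 0, zero_mul, zero_mul]
    intro hm
    have h1 := Int.modEq_iff_dvd.1 hm
    have h2 := Int.eq_zero_of_abs_lt_dvd h1 (by
      rw [abs_lt]
      constructor <;> push_cast <;> omega)
    apply hij
    ext
    push_cast at h2
    omega
  · have : q.1 ≠ 0 ∨ q.2 ≠ 0 := by
      by_contra! hc
      exact hq (Prod.ext hc.1 hc.2)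
    rcases this with h | h <;> simp [pt0, h]

lemma isIdealIn_ker_eval (hk : 1 ≤ k) (p : Bidisk) :
    IsIdealIn {F : C(Bidisk, Matrix (Fin k) (Fin k) ℂ) | memBk2 k F}
      {F | memBk2 k F ∧ F p = 0} := by
  refine ⟨fun F hF => hF.1, ⟨memBk2_zero hk, rfl⟩,
    fun F hF G hG => ⟨memBk2_add hk hF.1 hG.1, by simp [hF.2, hG.2]⟩,
    fun F hF => ⟨memBk2_neg hk hF.1, by simp [hF.2]⟩,
    fun F hF G hG => ⟨⟨memBk2_mul hk hF hG.1, by simp [hG.2]⟩,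
      ⟨memBk2_mul hk hG.1 hF, by simp [hG.2]⟩⟩⟩

lemma mul_apply_pt0 {F : C(Bidisk, Matrix (Fin k) (Fin k) ℂ)} (hF : memBk2 k F)
    (G : C(Bidisk, Matrix (Fin k) (Fin k) ℂ)) (l : Fin k) :
    (F * G) pt0 l l = F pt0 l l * G pt0 l l := by
  rw [ContinuousMap.mul_apply, Matrix.mul_apply]
  refine Finset.sum_eq_single l (fun i _ hi => ?_) (by simp)
  rw [apply_pt0_eq_zero hF hi.symm, zero_mul]

lemma isIdealIn_ker_diag (hk : 1 ≤ k) (l : Fin k) :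
    IsIdealIn {F : C(Bidisk, Matrix (Fin k) (Fin k) ℂ) | memBk2 k F}
      {F | memBk2 k F ∧ F pt0 l l = 0} := by
  refine ⟨fun F hF => hF.1, ⟨memBk2_zero hk, rfl⟩,
    fun F hF G hG => ⟨memBk2_add hk hF.1 hG.1, by simp [hF.2, hG.2]⟩,
    fun F hF => ⟨memBk2_neg hk hF.1, by simp [hF.2]⟩,
    fun F hF G hG => ⟨⟨memBk2_mul hk hF hG.1, ?_⟩, ⟨memBk2_mul hk hG.1 hF, ?_⟩⟩⟩
  · rw [mul_apply_pt0 hF, hG.2, mul_zero]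
  · rw [mul_apply_pt0 hG.1, hG.2, zero_mul]

/-- An ideal contained in none of the kernels is the whole algebra. -/
lemma eq_of_not_subset_ker (hk : 1 ≤ k) {J : Set C(Bidisk, Matrix (Fin k) (Fin k) ℂ)}
    (hJ : IsIdealIn {F | memBk2 k F} J)
    (heval : ∀ p : Bidisk, (p : ℂ × ℂ) ≠ 0 → ∃ F ∈ J, F p ≠ 0)
    (hdiag : ∀ l : Fin k, ∃ F ∈ J, F pt0 l l ≠ 0) : J = {F | memBk2 k F} := by
  obtain ⟨hsub, hzero, hadd, -, hmul⟩ := hJ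
  have hcorner : ∀ (l i j : Fin k) (f g : C(Bidisk, ℂ)), f ∈ homog k ((l : ℤ) - (i : ℤ)) →
      g ∈ homog k ((j : ℤ) - (l : ℤ)) → ∀ F ∈ J,
      f * entry F i j * g ∈ homog k 0 ∧ single l l (f * entry F i j * g) ∈ J := by
    intro l i j f g hf hg F hF
    refine ⟨?_, ?_⟩
    · have := mul_mem_homog (mul_mem_homog hf ((memBk2_iff hk F).1 (hsub hF) i j)) hg
      rwa [show (l : ℤ) - i + (i - j) + (j - l) = 0 by ring] at this
    · rw [← single_mul_mul_single]
      exact (hmul _ (memBk2_single hk hg) _ (hmul _ (memBk2_single hk hf) _ hF).1).2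
  have hone : ∀ l : Fin k, single l l 1 ∈ J := by
    intro l
    refine (one_mem_of_no_common_zero hk (I := {f | f ∈ homog k 0 ∧ single l l f ∈ J})
      (fun f hf => hf.1) ⟨Submodule.zero_mem _, ?_⟩ (fun f hf g hg => ⟨add_mem hf.1 hg.1, ?_⟩)
      (fun g hg f hf => ⟨?_, ?_⟩) fun p => ?_).2
    · convert hzero
      ext p a b
      simp [single_apply]
    · convert hadd _ hf.2 _ hg.2
      ext p a b
      simp [single_apply, Matrix.single_add]
    · simpa using mul_mem_homog hg hf.1
    · convert (hmul (single l l g) (memBk2_single hk (by simpa using hg)) _ hf.2).1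
      ext p a b
      simp [single_apply]
    · by_cases hp : (p : ℂ × ℂ) = 0
      · obtain rfl : p = pt0 := Subtype.ext hp
        obtain ⟨F, hF, hne⟩ := hdiag l
        refine ⟨_, hcorner l l l 1 1 (by simpa using one_mem_homog)
          (by simpa using one_mem_homog) F hF, ?_⟩
        simpa [entry] using hne
      · obtain ⟨F, hF, hne⟩ := heval p hp
        obtain ⟨i, j, hij⟩ : ∃ i j, F p i j ≠ 0 := by
          by_contra! h
          exact hne (Matrix.ext h)
        obtain ⟨f, hf, hfp⟩ := exists_homog_apply_ne_zero hk hp ((l : ℤ) - (i : ℤ))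
        obtain ⟨g, hg, hgp⟩ := exists_homog_apply_ne_zero hk hp ((j : ℤ) - (l : ℤ))
        exact ⟨_, hcorner l i j f g hf hg F hF, mul_ne_zero (mul_ne_zero hfp hij) hgp⟩
  have h1 : (1 : C(Bidisk, Matrix (Fin k) (Fin k) ℂ)) ∈ J := by
    rw [← sum_single_one]
    exact Finset.sum_induction _ (· ∈ J) (fun F G hF hG => hadd F hF G hG) hzero fun l _ => hone l
  refine hsub.antisymm fun F hF => ?_
  simpa using (hmul F hF 1 h1).1

end Matrices

end BidiskAlgebra

/-- every maximal proper two-sided ideal of `B_{k,2}` is either the kernel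
`{F : F(λ,μ) = 0}` of evaluation at some `(λ,μ) ≠ (0,0)` of the closed bidisk, or the
kernel `{F : f_{ℓℓ}(0,0) = 0}` of some `ψ₀^ℓ`, `ℓ ∈ {0,…,k-1}`. -/
theorem stmt8 (k : ℕ) (hk : 1 ≤ k) (J : Set C(Bidisk, Matrix (Fin k) (Fin k) ℂ))
    (hJ : IsMaxIdealIn {F : C(Bidisk, Matrix (Fin k) (Fin k) ℂ) | memBk2 k F} J) :
    (∃ p : Bidisk, (p : ℂ × ℂ) ≠ 0 ∧
      J = {F : C(Bidisk, Matrix (Fin k) (Fin k) ℂ) | memBk2 k F ∧ F p = 0}) ∨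
    (∃ l : Fin k,
      J = {F : C(Bidisk, Matrix (Fin k) (Fin k) ℂ) | memBk2 k F ∧ F pt0 l l = 0}) := by
  have hone := BidiskAlgebra.memBk2_one hk
  by_contra hcon
  rw [not_or] at hcon
  obtain ⟨hideal, hproper, hmax⟩ := hJ
  refine hproper (BidiskAlgebra.eq_of_not_subset_ker hk hideal (fun p hp => ?_) fun l => ?_)
  · by_contra! h
    rcases hmax _ (BidiskAlgebra.isIdealIn_ker_eval hk p) (fun F hF => ⟨hideal.1 hF, h F hF⟩)
      with h' | h'
    · exact hcon.1 ⟨p, hp, h'.symm⟩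
    · have h1 := (h'.symm.subset hone).2
      have : NeZero k := ⟨by omega⟩
      exact one_ne_zero h1
  · by_contra! h
    rcases hmax _ (BidiskAlgebra.isIdealIn_ker_diag hk l) (fun F hF => ⟨hideal.1 hF, h F hF⟩)
      with h' | h'
    · exact hcon.2 ⟨l, h'.symm⟩
    · have h1 := (h'.symm.subset hone).2
      simp at h1
end
end

section
/- Let k ≥ 1 and let P ∈ M_k(ℂ) be the cyclic permutation matrix with (P)_{ij} = 1 if i ≡ j + 1 (mod k) and 0 otherwise (indices in {0,…,k−1}). In the Banach algebra of continuous M_k(ℂ)-valued functions on the closed bidisk with the supremum norm, the smallest norm-closed subalgebra containing the functions (z,w) ↦ zP and (z,w) ↦ wP together with all constant diagonal matrices equals B_{k,2}. -/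
noncomputable section

/-- The cyclic permutation matrix `P` with `P i j = 1` iff `i ≡ j + 1 (mod k)`. -/
def cycP (k : ℕ) : Matrix (Fin k) (Fin k) ℂ :=
  Matrix.of fun i j => if (i : ℕ) % k = ((j : ℕ) + 1) % k then 1 else 0

/-- The function `(z,w) ↦ z P`. -/
def zPmap (k : ℕ) : C(Bidisk, Matrix (Fin k) (Fin k) ℂ) :=
  ⟨fun p => (p : ℂ × ℂ).1 • cycP k, (continuous_subtype_val.fst).smul continuous_const⟩

/-- The function `(z,w) ↦ w P`. -/
def wPmap (k : ℕ) : C(Bidisk, Matrix (Fin k) (Fin k) ℂ) :=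
  ⟨fun p => (p : ℂ × ℂ).2 • cycP k, (continuous_subtype_val.snd).smul continuous_const⟩

/-- The generators: `zP`, `wP`, and all constant diagonal-matrix functions. -/
def gens (k : ℕ) : Set C(Bidisk, Matrix (Fin k) (Fin k) ℂ) :=
  {zPmap k, wPmap k} ∪
    {F | ∃ D : Matrix (Fin k) (Fin k) ℂ, D.IsDiag ∧ F = ContinuousMap.const Bidisk D}

/-- The monomial `z ^ m * w ^ n` as a continuous function on the closed bidisk. -/
def monomialMap (m n : ℕ) : C(Bidisk, ℂ) :=
  ⟨fun p => (p : ℂ × ℂ).1 ^ m * (p : ℂ × ℂ).2 ^ n,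
    (continuous_subtype_val.fst.pow m).mul (continuous_subtype_val.snd.pow n)⟩

/-- The span of the monomials of total degree congruent to `c` modulo `k`. -/
def homogSpan (k : ℕ) (c : ℤ) : Submodule ℂ C(Bidisk, ℂ) :=
  Submodule.span ℂ {g | ∃ m n : ℕ, (m : ℤ) + n ≡ c [ZMOD k] ∧ g = monomialMap m n}

/-- The parametrization of the distinguished boundary of the bidisk. -/
def boundaryMap : C(UnitAddCircle × UnitAddCircle, Bidisk) :=
  ⟨fun x => ⟨(fourier 1 x.1, fourier 1 x.2), by
    simp [Bidisk, fourier_apply, Circle.norm_coe]⟩, by fun_prop⟩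

lemma coe_boundaryMap (x : UnitAddCircle × UnitAddCircle) :
    (boundaryMap x : ℂ × ℂ) = (fourier 1 x.1, fourier 1 x.2) := rfl

lemma fourier_one_pow (m : ℕ) (x : UnitAddCircle) :
    (fourier 1 x : ℂ) ^ m = fourier (m : ℤ) x := by
  induction m with
  | zero => simp
  | succ m ih => rw [pow_succ, ih, Nat.cast_succ, fourier_add]

lemma integral_fourier_neg_mul (m q : ℤ) :
    ∫ x : UnitAddCircle, fourier (-m) x * fourier q x ∂AddCircle.haarAddCircle =
      if m = q then 1 else 0 := by
  have h := (orthonormal_iff_ite.mp (orthonormal_fourier (T := 1))) m q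
  rw [← h, MeasureTheory.ContinuousMap.inner_toLp]
  simp [mul_comm]

/-- The Fourier coefficient of index `(m, n)` of the boundary values of a function on the
closed bidisk. -/
def torusCoeff (m n : ℕ) : C(Bidisk, ℂ) →L[ℂ] ℂ :=
  LinearMap.mkContinuous
    { toFun := fun f => ∫ x : UnitAddCircle × UnitAddCircle,
        (fourier (-m : ℤ) x.1 * fourier (-n : ℤ) x.2) * f (boundaryMap x)
          ∂(AddCircle.haarAddCircle.prod AddCircle.haarAddCircle)
      map_add' := fun f g => by
        simp only [ContinuousMap.add_apply, mul_add]
        apply MeasureTheory.integral_add <;>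
        exact Continuous.integrable_of_hasCompactSupport (by fun_prop)
          (HasCompactSupport.of_compactSpace _)
      map_smul' := fun c f => by
        simp only [ContinuousMap.smul_apply, smul_eq_mul, RingHom.id_apply, mul_left_comm _ c]
        exact MeasureTheory.integral_const_mul c _ }
    1 fun f => by
      have h := MeasureTheory.norm_integral_le_of_norm_le_const
        (μ := AddCircle.haarAddCircle.prod AddCircle.haarAddCircle) (C := ‖f‖)
        (f := fun x : UnitAddCircle × UnitAddCircle =>
          (fourier (-m : ℤ) x.1 * fourier (-n : ℤ) x.2) * f (boundaryMap x))
        (Filter.Eventually.of_forall fun x => by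
          simpa [fourier_apply, Circle.norm_coe] using f.norm_coe_le_norm (boundaryMap x))
      simpa using h

lemma torusCoeff_apply (m n : ℕ) (f : C(Bidisk, ℂ)) :
    torusCoeff m n f = ∫ x : UnitAddCircle × UnitAddCircle,
      (fourier (-m : ℤ) x.1 * fourier (-n : ℤ) x.2) * f (boundaryMap x)
        ∂(AddCircle.haarAddCircle.prod AddCircle.haarAddCircle) := rfl

lemma norm_torusCoeff_le (m n : ℕ) : ‖torusCoeff m n‖ ≤ 1 :=
  LinearMap.mkContinuous_norm_le _ zero_le_one _

lemma torusCoeff_monomialMap (m n q r : ℕ) :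
    torusCoeff m n (monomialMap q r) = if (m, n) = (q, r) then 1 else 0 := by
  have h := MeasureTheory.integral_prod_mul (μ := AddCircle.haarAddCircle)
    (ν := AddCircle.haarAddCircle)
    (fun x : UnitAddCircle => (fourier (-m : ℤ) x * fourier (q : ℤ) x : ℂ))
    (fun x : UnitAddCircle => (fourier (-n : ℤ) x * fourier (r : ℤ) x : ℂ))
  rw [integral_fourier_neg_mul, integral_fourier_neg_mul] at h
  rw [torusCoeff_apply]
  simp only [monomialMap, ContinuousMap.coe_mk, coe_boundaryMap, fourier_one_pow]
  simp only [mul_mul_mul_comm, h]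
  simp [Prod.ext_iff, ← ite_and, and_comm]

/-- The sum of the power series with the boundary Fourier coefficients recovers `f` at `p`. -/
lemma hasSum_torusCoeff {k : ℕ} {c : ℤ} {f : C(Bidisk, ℂ)}
    (hf : f ∈ closure (homogSpan k c : Set C(Bidisk, ℂ))) :
    HasCoeffsAt f fun m n => torusCoeff m n f := by
  intro p hz hw
  obtain ⟨⟨z, w⟩, hp⟩ := p
  let t : ℕ × ℕ → C(Bidisk, ℂ) →L[ℂ] ℂ := fun mn => (z ^ mn.1 * w ^ mn.2) • torusCoeff mn.1 mn.2
  have ht : Summable t := by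
    refine Summable.of_norm_bounded
      ((summable_geometric_of_lt_one (norm_nonneg z) hz).mul_of_nonneg
        (summable_geometric_of_lt_one (norm_nonneg w) hw) (fun _ => by positivity)
        (fun _ => by positivity)) fun mn => ?_
    simp only [t, norm_smul, norm_mul, norm_pow]
    exact mul_le_of_le_one_right (by positivity) (norm_torusCoeff_le _ _)
  have hsum : ∀ g : C(Bidisk, ℂ), HasSum (fun mn => t mn g) ((∑' mn, t mn) g) := fun g =>
    ht.hasSum.mapL (ContinuousLinearMap.apply ℂ ℂ g)
  have heq : Set.EqOn (∑' mn, t mn : C(Bidisk, ℂ) →L[ℂ] ℂ)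
      (ContinuousMap.evalCLM ℂ (⟨(z, w), hp⟩ : Bidisk) : C(Bidisk, ℂ) →L[ℂ] ℂ)
      {g | ∃ m n : ℕ, (m : ℤ) + n ≡ c [ZMOD k] ∧ g = monomialMap m n} := by
    rintro _ ⟨q, r, -, rfl⟩
    refine (hsum _).unique ?_
    convert hasSum_ite_eq (q, r) (z ^ q * w ^ r) using 2 with mn
    · simp only [t, smul_apply, torusCoeff_monomialMap]
      split_ifs with h
      · obtain rfl : mn = (q, r) := h
        simp
      · rw [smul_zero]
    · rfl
  have h := hsum f
  rw [ContinuousLinearMap.eqOn_closure_span heq hf] at h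
  convert h using 2 with mn
  · simp only [t, smul_apply, smul_eq_mul]
    ring
  · rfl

lemma torusCoeff_eq_zero {k : ℕ} {c : ℤ} {f : C(Bidisk, ℂ)}
    (hf : f ∈ closure (homogSpan k c : Set C(Bidisk, ℂ))) {m n : ℕ}
    (hmn : ¬ (m : ℤ) + n ≡ c [ZMOD k]) : torusCoeff m n f = 0 := by
  refine ContinuousLinearMap.eqOn_closure_span (g := 0) ?_ hf
  rintro _ ⟨q, r, hqr, rfl⟩
  rw [torusCoeff_monomialMap, if_neg]
  · rfl
  · rintro ⟨⟩
    exact hmn hqr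

/-- The dilation `p ↦ r p` of the closed bidisk. -/
def dilation (r : unitInterval) (p : Bidisk) : Bidisk :=
  ⟨((r : ℂ) * (p : ℂ × ℂ).1, (r : ℂ) * (p : ℂ × ℂ).2), by
    obtain ⟨⟨z, w⟩, hz, hw⟩ := p
    obtain ⟨r, h0, h1⟩ := r
    simp only [mem_closedBall_zero_iff] at hz hw
    simp only [Bidisk, Set.mem_prod, mem_closedBall_zero_iff, norm_mul, Complex.norm_real,
      Real.norm_of_nonneg h0]
    exact ⟨mul_le_one₀ h1 (norm_nonneg _) hz, mul_le_one₀ h1 (norm_nonneg _) hw⟩⟩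

lemma continuous_dilation : Continuous fun x : unitInterval × Bidisk => dilation x.1 x.2 := by
  unfold dilation
  fun_prop

/-- A continuous function whose power series is supported in the degrees congruent to `c` is a
uniform limit of polynomials with the same support. -/
lemma mem_closure_homogSpan {k : ℕ} {c : ℤ} {f : C(Bidisk, ℂ)} {a : ℕ → ℕ → ℂ}
    (hf : HasCoeffsAt f a) (ha : ∀ m n : ℕ, ¬ (m : ℤ) + n ≡ c [ZMOD k] → a m n = 0) :
    f ∈ closure (homogSpan k c : Set C(Bidisk, ℂ)) := by
  let D : C(unitInterval × Bidisk, ℂ) := f.comp ⟨_, continuous_dilation⟩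
  have hD : ∀ r : unitInterval, (r : ℝ) < 1 →
      D.curry r ∈ closure (homogSpan k c : Set C(Bidisk, ℂ)) := by
    rintro ⟨r, h0, h1⟩ hr
    have hnorm : ‖(r : ℂ)‖ = r := by simp [abs_of_nonneg h0]
    let s : ℕ × ℕ → C(Bidisk, ℂ) := fun mn => (a mn.1 mn.2 * r ^ mn.1 * r ^ mn.2) •
      monomialMap mn.1 mn.2
    have hs : Summable s := by
      have h := (hf (dilation ⟨r, h0, h1⟩ ⟨(1, 1), by simp [Bidisk]⟩)
        (by simpa [dilation, abs_of_nonneg h0] using hr)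
        (by simpa [dilation, abs_of_nonneg h0] using hr)).summable.norm
      refine Summable.of_norm_bounded h fun mn => ?_
      simp only [s, norm_smul, dilation, mul_one]
      refine mul_le_of_le_one_right (norm_nonneg _) ?_
      rw [ContinuousMap.norm_le _ zero_le_one]
      rintro ⟨⟨z, w⟩, hz, hw⟩
      simp only [mem_closedBall_zero_iff] at hz hw
      simp only [monomialMap, ContinuousMap.coe_mk, norm_mul, norm_pow]
      exact mul_le_one₀ (pow_le_one₀ (norm_nonneg _) hz) (by positivity)
        (pow_le_one₀ (norm_nonneg _) hw)
    have hD' : D.curry ⟨r, h0, h1⟩ = ∑' mn, s mn := by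
      ext p
      have h1' := hs.hasSum.mapL (ContinuousMap.evalCLM ℂ p : C(Bidisk, ℂ) →L[ℂ] ℂ)
      have hlt : ∀ u : ℂ, ‖u‖ ≤ 1 → ‖(r : ℂ) * u‖ < 1 := fun u hu => by
        rw [norm_mul, hnorm]
        exact (mul_le_of_le_one_right h0 hu).trans_lt hr
      have h2 := hf (dilation ⟨r, h0, h1⟩ p)
        (hlt _ (mem_closedBall_zero_iff.mp p.2.1)) (hlt _ (mem_closedBall_zero_iff.mp p.2.2))
      refine h2.unique ?_
      convert h1' using 2 with mn
      · simp [s, dilation, monomialMap]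
        ring
      · rfl
    rw [hD']
    refine mem_closure_of_tendsto hs.hasSum (Filter.Eventually.of_forall fun u => ?_)
    refine Submodule.sum_mem _ fun mn _ => ?_
    by_cases h : (mn.1 : ℤ) + mn.2 ≡ c [ZMOD k]
    · exact Submodule.smul_mem _ _ (Submodule.subset_span ⟨_, _, h, rfl⟩)
    · simp [s, ha _ _ h]
  have hf1 : D.curry 1 = f := by
    ext p
    simp [D, dilation]
  rw [← hf1]
  have hseq : Filter.Tendsto (fun n : ℕ => D.curry (unitInterval.symm ⟨1 / ((n : ℝ) + 1),
      by positivity, by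
        rw [div_le_one (by positivity)]; linarith [(Nat.cast_nonneg n : (0 : ℝ) ≤ n)]⟩))
      Filter.atTop (nhds (D.curry 1)) := by
    refine (D.curry.continuous.tendsto 1).comp ?_
    rw [tendsto_subtype_rng]
    simpa using (tendsto_const_nhds (x := (1 : ℝ))).sub
      (tendsto_one_div_add_atTop_nhds_zero_nat (𝕜 := ℝ))
  refine isClosed_closure.mem_of_tendsto hseq (Filter.Eventually.of_forall fun n => hD _ ?_)
  simp only [unitInterval.coe_symm_eq, sub_lt_self_iff]
  positivity

lemma monomialMap_mul (m n q r : ℕ) :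
    monomialMap m n * monomialMap q r = monomialMap (m + q) (n + r) := by
  ext p
  simp [monomialMap]
  ring

lemma mul_mem_homogSpan {k : ℕ} {c d e : ℤ} (h : c + d = e) {f g : C(Bidisk, ℂ)}
    (hf : f ∈ homogSpan k c) (hg : g ∈ homogSpan k d) : f * g ∈ homogSpan k e := by
  have hle : homogSpan k c * homogSpan k d ≤ homogSpan k e := by
    rw [homogSpan, homogSpan, Submodule.span_mul_span, Submodule.span_le]
    rintro _ ⟨_, ⟨m, n, hmn, rfl⟩, _, ⟨q, r, hqr, rfl⟩, rfl⟩
    refine Submodule.subset_span ⟨m + q, n + r, ?_, monomialMap_mul _ _ _ _⟩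
    have := hmn.add hqr
    rw [h] at this
    convert this using 1
    push_cast
    ring
  exact hle (Submodule.mul_mem_mul hf hg)

lemma const_mem_homogSpan (k : ℕ) (a : ℂ) : ContinuousMap.const Bidisk a ∈ homogSpan k 0 := by
  have h : ContinuousMap.const Bidisk a = a • monomialMap 0 0 := by
    ext p
    simp [monomialMap]
  rw [h]
  exact Submodule.smul_mem _ _ (Submodule.subset_span ⟨0, 0, by simp, rfl⟩)

/-- The `(i, j)` entry of a matrix-valued function. -/
def entryMap {k : ℕ} (i j : Fin k) :
    C(Bidisk, Matrix (Fin k) (Fin k) ℂ) →L[ℂ] C(Bidisk, ℂ) :=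
  ContinuousLinearMap.compLeftContinuous ℂ Bidisk
    ⟨Matrix.entryLinearMap ℂ ℂ i j, continuous_id.matrix_elem i j⟩

lemma entryMap_apply {k : ℕ} (i j : Fin k) (F : C(Bidisk, Matrix (Fin k) (Fin k) ℂ))
    (p : Bidisk) : entryMap i j F p = F p i j := rfl

/-- The matrix-valued function with `(i, j)` entry `f` and all other entries zero. -/
def singleMap {k : ℕ} (i j : Fin k) :
    C(Bidisk, ℂ) →L[ℂ] C(Bidisk, Matrix (Fin k) (Fin k) ℂ) :=
  ContinuousLinearMap.compLeftContinuous ℂ Bidisk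
    ⟨Matrix.singleLinearMap ℂ i j, continuous_matrix fun a b => by
      by_cases h : i = a ∧ j = b
      · simpa [Matrix.single, h] using continuous_id'
      · simpa [Matrix.single, h] using continuous_const⟩

lemma singleMap_apply {k : ℕ} (i j : Fin k) (f : C(Bidisk, ℂ)) (p : Bidisk) :
    singleMap i j f p = Matrix.single i j (f p) := rfl

lemma sum_singleMap_entryMap {k : ℕ} (F : C(Bidisk, Matrix (Fin k) (Fin k) ℂ)) :
    ∑ i, ∑ j, singleMap i j (entryMap i j F) = F := by
  ext1 p
  simp only [ContinuousMap.sum_apply, singleMap_apply, entryMap_apply]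
  exact (Matrix.matrix_eq_sum_single (F p)).symm

lemma cycP_pow_apply {k : ℕ} (N : ℕ) (i j : Fin k) :
    (cycP k ^ N) i j = if (i : ℕ) ≡ j + N [MOD k] then 1 else 0 := by
  have hk : 0 < k := i.pos
  induction N generalizing j with
  | zero =>
    simp only [pow_zero, Matrix.one_apply, add_zero, Nat.ModEq, Nat.mod_eq_of_lt i.2,
      Nat.mod_eq_of_lt j.2, Fin.ext_iff]
  | succ N ih =>
    rw [pow_succ, Matrix.mul_apply,
      Finset.sum_eq_single (⟨((j : ℕ) + 1) % k, Nat.mod_lt _ hk⟩ : Fin k)]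
    · rw [ih]
      have h : (i : ℕ) ≡ ((j : ℕ) + 1) % k + N [MOD k] ↔ (i : ℕ) ≡ j + (N + 1) [MOD k] := by
        simp only [Nat.ModEq, Nat.mod_add_mod]
        rw [add_assoc, add_comm 1 N]
      simp [cycP, h]
    · intro b _ hb
      have : ¬ (b : ℕ) % k = ((j : ℕ) + 1) % k := fun h => hb (Fin.ext (by
        rwa [Nat.mod_eq_of_lt b.2] at h))
      simp [cycP, this]
    · simp

lemma entryMap_gens_mem {k : ℕ} {F : C(Bidisk, Matrix (Fin k) (Fin k) ℂ)} (hF : F ∈ gens k)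
    (i j : Fin k) : entryMap i j F ∈ homogSpan k (i - j) := by
  have hP : ∀ m n : ℕ, m + n = 1 →
      cycP k i j • monomialMap m n ∈ homogSpan k ((i : ℤ) - j) := fun m n hmn => by
    by_cases h : (i : ℕ) % k = ((j : ℕ) + 1) % k
    · refine Submodule.smul_mem _ _ (Submodule.subset_span ⟨m, n, ?_, rfl⟩)
      have h' : ((i : ℕ) : ℤ) ≡ ((j + 1 : ℕ) : ℤ) [ZMOD k] := Int.natCast_modEq_iff.mpr h
      have h2 := (h'.sub_right (j : ℤ)).symm
      have h3 : ((j + 1 : ℕ) : ℤ) - (j : ℤ) = (m : ℤ) + n := by omega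
      rwa [h3] at h2
    · simp [cycP, h]
  obtain (rfl | rfl) | ⟨D, hD, rfl⟩ := hF
  · convert hP 1 0 rfl using 1
    ext p
    simp [entryMap_apply, zPmap, monomialMap, mul_comm]
  · convert hP 0 1 rfl using 1
    ext p
    simp [entryMap_apply, wPmap, monomialMap, mul_comm]
  · by_cases h : i = j
    · subst h
      rw [sub_self]
      exact const_mem_homogSpan k (D i i)
    · convert Submodule.zero_mem _ using 1
      ext p
      exact hD h

lemma entryMap_adjoin_mem {k : ℕ} {F : C(Bidisk, Matrix (Fin k) (Fin k) ℂ)}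
    (hF : F ∈ Algebra.adjoin ℂ (gens k)) (i j : Fin k) :
    entryMap i j F ∈ homogSpan k (i - j) := by
  induction hF using Algebra.adjoin_induction generalizing i j with
  | mem F hF => exact entryMap_gens_mem hF i j
  | algebraMap r =>
    refine entryMap_gens_mem (Or.inr ⟨algebraMap ℂ _ r, ?_, rfl⟩) i j
    rw [Matrix.algebraMap_eq_diagonal]
    exact Matrix.isDiag_diagonal _
  | add F G _ _ hF hG =>
    rw [map_add]
    exact Submodule.add_mem _ (hF i j) (hG i j)
  | mul F G _ _ hF hG =>
    have h : entryMap i j (F * G) = ∑ l, entryMap i l F * entryMap l j G := by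
      ext p
      simp [entryMap_apply, Matrix.mul_apply]
    rw [h]
    exact Submodule.sum_mem _ fun l _ => mul_mem_homogSpan (by ring) (hF i l) (hG l j)

lemma singleMap_monomialMap_mem {k m n : ℕ} {i j : Fin k}
    (h : (m : ℤ) + n ≡ (i : ℤ) - j [ZMOD k]) :
    singleMap i j (monomialMap m n) ∈ Algebra.adjoin ℂ (gens k) := by
  have hdiag : ∀ l : Fin k, ContinuousMap.const Bidisk (Matrix.single l l (1 : ℂ)) ∈
      Algebra.adjoin ℂ (gens k) := fun l =>
    Algebra.subset_adjoin (Or.inr ⟨_, by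
      rw [← Matrix.diagonal_single]; exact Matrix.isDiag_diagonal _, rfl⟩)
  have hz : zPmap k ∈ Algebra.adjoin ℂ (gens k) :=
    Algebra.subset_adjoin (Or.inl (Or.inl rfl))
  have hw : wPmap k ∈ Algebra.adjoin ℂ (gens k) :=
    Algebra.subset_adjoin (Or.inl (Or.inr rfl))
  have hij : (i : ℕ) ≡ j + (m + n) [MOD k] := by
    rw [← Int.natCast_modEq_iff]
    have := (h.add_left (j : ℤ)).symm
    push_cast
    rwa [add_sub_cancel] at this
  convert mul_mem (mul_mem (hdiag i) (mul_mem (pow_mem hz m) (pow_mem hw n))) (hdiag j) using 1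
  ext1 p
  simp only [singleMap_apply, ContinuousMap.mul_apply, ContinuousMap.pow_apply,
    ContinuousMap.const_apply, zPmap, wPmap, ContinuousMap.coe_mk, smul_pow, smul_mul_smul_comm,
    ← pow_add, Matrix.single_mul_mul_single]
  simp [cycP_pow_apply, hij, monomialMap]

lemma singleMap_mem {k : ℕ} {i j : Fin k} {f : C(Bidisk, ℂ)}
    (hf : f ∈ homogSpan k (i - j)) : singleMap i j f ∈ Algebra.adjoin ℂ (gens k) := by
  have hle : homogSpan k (i - j) ≤
      (Subalgebra.toSubmodule (Algebra.adjoin ℂ (gens k))).comap (singleMap i j).toLinearMap := by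
    rw [homogSpan, Submodule.span_le]
    rintro _ ⟨m, n, h, rfl⟩
    exact singleMap_monomialMap_mem h
  exact hle hf

/-- the smallest norm-closed subalgebra of the continuous `M_k(ℂ)`-valued
functions on the closed bidisk containing `(z,w) ↦ zP`, `(z,w) ↦ wP` and the constant
diagonal matrices is exactly `B_{k,2}`. -/
theorem stmt9 (k : ℕ) (hk : 1 ≤ k) :
    closure (Algebra.adjoin ℂ (gens k) : Set C(Bidisk, Matrix (Fin k) (Fin k) ℂ)) =
      {F : C(Bidisk, Matrix (Fin k) (Fin k) ℂ) | memBk2 k F} := by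
  ext F
  constructor
  · intro hF i j
    have h : entryMap i j F ∈ closure (homogSpan k (i - j) : Set C(Bidisk, ℂ)) :=
      map_mem_closure (entryMap i j).continuous hF fun G hG => entryMap_adjoin_mem hG i j
    have hF' : (fun p => F p i j) = entryMap i j F := funext fun p => (entryMap_apply i j F p).symm
    rw [hF']
    generalize entryMap i j F = f at h
    exact ⟨fun m n => torusCoeff m n f, hasSum_torusCoeff h,
      fun m n hmn => torusCoeff_eq_zero h hmn⟩
  · intro hF
    change F ∈ (Algebra.adjoin ℂ (gens k)).topologicalClosure
    rw [← sum_singleMap_entryMap F]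
    refine sum_mem fun i _ => sum_mem fun j _ => ?_
    obtain ⟨a, ha, ha0⟩ := hF i j
    exact map_mem_closure (singleMap i j).continuous
      (mem_closure_homogSpan (f := entryMap i j F) ha ha0) fun f hf => singleMap_mem hf
end
end

section
/- Let k, ℓ ≥ 1 and let A_{k,ℓ}(𝔻²) be the subset of the bidisk algebra A(𝔻²) consisting of those f whose power series coefficients satisfy a_{mn} = 0 unless k divides m and ℓ divides n (this is the concrete realization of A_k(𝔻) ⊗̂ A_ℓ(𝔻)); it is a unital Banach subalgebra of A(𝔻²). Then every character (nonzero multiplicative linear functional) of A_{k,ℓ}(𝔻²) is evaluation at some point (λ, μ) of the closed bidisk, and consequently every maximal ideal of A_{k,ℓ}(𝔻²) is of the form { f : f(λ, μ) = 0 } for some (λ, μ) in the closed bidisk. -/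
noncomputable section

/-- Membership in `A_{k,ℓ}(𝔻²) = A_k(𝔻) ⊗̂ A_ℓ(𝔻)`: member of the bidisk algebra whose
power series coefficients `a m n` vanish unless `k ∣ m` and `ℓ ∣ n`. -/
def memAkl (k l : ℕ) (f : C(Bidisk, ℂ)) : Prop :=
  ∃ a : ℕ → ℕ → ℂ, HasCoeffsAt (⇑f) a ∧ ∀ m n : ℕ, ¬ (k ∣ m ∧ l ∣ n) → a m n = 0

open MeasureTheory

namespace Bidisk

/-- The first coordinate function on the closed bidisk. -/
def coordFst : C(Bidisk, ℂ) := ⟨fun p => (p : ℂ × ℂ).1, by fun_prop⟩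

/-- The second coordinate function on the closed bidisk. -/
def coordSnd : C(Bidisk, ℂ) := ⟨fun p => (p : ℂ × ℂ).2, by fun_prop⟩

@[simp] lemma coordFst_apply (p : Bidisk) : coordFst p = (p : ℂ × ℂ).1 := rfl

@[simp] lemma coordSnd_apply (p : Bidisk) : coordSnd p = (p : ℂ × ℂ).2 := rfl

lemma mem_iff {p : ℂ × ℂ} : p ∈ Bidisk ↔ ‖p.1‖ ≤ 1 ∧ ‖p.2‖ ≤ 1 := by
  simp [Bidisk, Set.mem_prod]

lemma norm_coordFst_le : ‖coordFst‖ ≤ 1 :=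
  (ContinuousMap.norm_le _ zero_le_one).2 fun p => (mem_iff.1 p.2).1

lemma norm_coordSnd_le : ‖coordSnd‖ ≤ 1 :=
  (ContinuousMap.norm_le _ zero_le_one).2 fun p => (mem_iff.1 p.2).2

instance : Nonempty Bidisk := ⟨⟨0, by simp [mem_iff]⟩⟩

lemma norm_monomial_le (m n : ℕ) : ‖coordFst ^ m * coordSnd ^ n‖ ≤ 1 := by
  refine (norm_mul_le _ _).trans (mul_le_one₀ ?_ (norm_nonneg _) ?_)
  · exact (norm_pow_le _ _).trans (pow_le_one₀ (norm_nonneg _) norm_coordFst_le)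
  · exact (norm_pow_le _ _).trans (pow_le_one₀ (norm_nonneg _) norm_coordSnd_le)

/-- The parametrization of the distinguished boundary of the bidisk. -/
def torus : C(UnitAddCircle × UnitAddCircle, Bidisk) where
  toFun x := ⟨(AddCircle.toCircle x.1, AddCircle.toCircle x.2),
    mem_iff.2 ⟨(Circle.norm_coe _).le, (Circle.norm_coe _).le⟩⟩
  continuous_toFun := by
    refine Continuous.subtype_mk (Continuous.prodMk ?_ ?_) _
    · exact continuous_subtype_val.comp (AddCircle.continuous_toCircle.comp continuous_fst)
    · exact continuous_subtype_val.comp (AddCircle.continuous_toCircle.comp continuous_snd)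

/-- The normalized Haar measure on the two-dimensional torus. -/
def torusMeasure : Measure (UnitAddCircle × UnitAddCircle) :=
  AddCircle.haarAddCircle.prod AddCircle.haarAddCircle

instance : IsProbabilityMeasure torusMeasure := by
  unfold torusMeasure; infer_instance

/-- The conjugate character of the torus with frequencies `m` and `n`. -/
def torusChar (m n : ℕ) : C(UnitAddCircle × UnitAddCircle, ℂ) :=
  (fourier (-m)).comp ContinuousMap.fst * (fourier (-n)).comp ContinuousMap.snd

lemma norm_torusChar_apply (m n : ℕ) (x : UnitAddCircle × UnitAddCircle) :
    ‖torusChar m n x‖ = 1 := by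
  simp only [torusChar, ContinuousMap.mul_apply, ContinuousMap.comp_apply, fourier_apply, norm_mul,
    Circle.norm_coe, mul_one]

lemma integral_fourier (n : ℤ) :
    ∫ x : UnitAddCircle, fourier n x ∂AddCircle.haarAddCircle = if n = 0 then 1 else 0 := by
  split_ifs with h
  · simp [h]
  · exact integral_eq_zero_of_add_right_eq_neg
      (fourier_add_half_inv_index h (by norm_num : (0 : ℝ) < 1))

lemma integrable_torus (g : C(UnitAddCircle × UnitAddCircle, ℂ)) :
    Integrable g torusMeasure :=
  g.continuous.integrable_of_hasCompactSupport (HasCompactSupport.of_compactSpace _)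

/-- The Fourier coefficient of a continuous function along the distinguished boundary. -/
def coeff (m n : ℕ) : C(Bidisk, ℂ) →L[ℂ] ℂ :=
  LinearMap.mkContinuous
    { toFun := fun f => ∫ x, (f.comp torus * torusChar m n) x ∂torusMeasure
      map_add' := fun f g => by
        rw [← integral_add (integrable_torus _) (integrable_torus _)]
        simp [add_mul]
      map_smul' := fun c f => by
        rw [RingHom.id_apply, ← integral_smul]
        simp [mul_assoc] } 1 fun f => by
    simp only [LinearMap.coe_mk, AddHom.coe_mk]
    refine (norm_integral_le_of_norm_le_const (C := ‖f‖) (Filter.Eventually.of_forall fun x => ?_)).trans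
      (by simp)
    simpa [norm_torusChar_apply] using f.norm_coe_le_norm (torus x)

lemma norm_coeff_le (m n : ℕ) : ‖coeff m n‖ ≤ 1 := LinearMap.mkContinuous_norm_le _ zero_le_one _

lemma coeff_monomial (m n a b : ℕ) :
    coeff m n (coordFst ^ a * coordSnd ^ b) = if a = m ∧ b = n then 1 else 0 := by
  have h : coeff m n (coordFst ^ a * coordSnd ^ b) =
      ∫ x, fourier (a - m : ℤ) x.1 * fourier (b - n : ℤ) x.2 ∂torusMeasure := by
    refine integral_congr_ae (Filter.Eventually.of_forall fun x => ?_)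
    simp only [torusChar, ContinuousMap.mul_apply, ContinuousMap.comp_apply,
      ContinuousMap.pow_apply, coordFst_apply, coordSnd_apply, torus, ContinuousMap.coe_mk,
      ContinuousMap.fst_apply, ContinuousMap.snd_apply, sub_eq_add_neg, fourier_add]
    simp only [fourier_apply, natCast_zsmul, AddCircle.toCircle_nsmul, Circle.coe_pow]
    ring
  rw [h, torusMeasure, integral_prod_mul, integral_fourier, integral_fourier]
  simp only [sub_eq_zero, Nat.cast_inj]
  split_ifs <;> simp_all

/-- The closed subalgebra of `C(Bidisk, ℂ)` generated by `z ^ k` and `w ^ l`. -/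
def powerAlgebra (k l : ℕ) : Subalgebra ℂ C(Bidisk, ℂ) :=
  (Algebra.adjoin ℂ {coordFst ^ k, coordSnd ^ l}).topologicalClosure

instance (k l : ℕ) : CompleteSpace (powerAlgebra k l) :=
  (Subalgebra.isClosed_topologicalClosure _).completeSpace_coe

instance (k l : ℕ) : NormOneClass (powerAlgebra k l) :=
  ⟨norm_one (α := C(Bidisk, ℂ))⟩

lemma isClosed_powerAlgebra (k l : ℕ) : IsClosed (powerAlgebra k l : Set C(Bidisk, ℂ)) :=
  Subalgebra.isClosed_topologicalClosure _

lemma coordFst_pow_mem (k l : ℕ) : coordFst ^ k ∈ powerAlgebra k l :=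
  Subalgebra.le_topologicalClosure _ (Algebra.subset_adjoin (by simp))

lemma coordSnd_pow_mem (k l : ℕ) : coordSnd ^ l ∈ powerAlgebra k l :=
  Subalgebra.le_topologicalClosure _ (Algebra.subset_adjoin (by simp))

lemma eqOn_powerAlgebra {k l : ℕ} {F : Type*} [TopologicalSpace F] [AddCommMonoid F] [Module ℂ F]
    [T2Space F] {φ ψ : C(Bidisk, ℂ) →L[ℂ] F}
    (h : ∀ a b : ℕ, φ (coordFst ^ (k * a) * coordSnd ^ (l * b)) =
      ψ (coordFst ^ (k * a) * coordSnd ^ (l * b)))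
    {f : C(Bidisk, ℂ)} (hf : f ∈ powerAlgebra k l) : φ f = ψ f := by
  have hspan : Set.EqOn φ ψ (Algebra.adjoin ℂ {coordFst ^ k, coordSnd ^ l} : Set C(Bidisk, ℂ)) := by
    rw [← Subalgebra.coe_toSubmodule, Algebra.adjoin_eq_span]
    refine LinearMap.eqOn_span (f := (φ : C(Bidisk, ℂ) →ₗ[ℂ] F)) (g := ψ) fun x hx => ?_
    obtain ⟨a, b, rfl⟩ := (Submonoid.mem_closure_pair _ _ _).1 hx
    simp only [← pow_mul]
    exact h a b
  exact hspan.closure φ.continuous ψ.continuous hf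

/-- The sum of the power series with the Fourier coefficients of a function, at a point of
`ℂ × ℂ`, as a functional of the function. -/
def seriesAt (z w : ℂ) : C(Bidisk, ℂ) →L[ℂ] ℂ :=
  ∑' mn : ℕ × ℕ, (z ^ mn.1 * w ^ mn.2) • coeff mn.1 mn.2

lemma hasSum_seriesAt {z w : ℂ} (hz : ‖z‖ < 1) (hw : ‖w‖ < 1) (f : C(Bidisk, ℂ)) :
    HasSum (fun mn : ℕ × ℕ => coeff mn.1 mn.2 f * z ^ mn.1 * w ^ mn.2) (seriesAt z w f) := by
  have hs : Summable fun mn : ℕ × ℕ => (z ^ mn.1 * w ^ mn.2) • coeff mn.1 mn.2 := by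
    refine Summable.of_norm_bounded (g := fun mn : ℕ × ℕ => ‖z‖ ^ mn.1 * ‖w‖ ^ mn.2)
      ((summable_geometric_of_lt_one (norm_nonneg _) hz).mul_of_nonneg
        (summable_geometric_of_lt_one (norm_nonneg _) hw) (fun _ => by positivity)
        (fun _ => by positivity)) fun mn => ?_
    rw [norm_smul, norm_mul, norm_pow, norm_pow]
    exact mul_le_of_le_one_right (by positivity) (norm_coeff_le _ _)
  have h := hs.hasSum.mapL (ContinuousLinearMap.apply ℂ ℂ f)
  refine h.congr_fun fun mn => ?_
  simp
  ring

lemma seriesAt_monomial {z w : ℂ} (hz : ‖z‖ < 1) (hw : ‖w‖ < 1) (a b : ℕ) :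
    seriesAt z w (coordFst ^ a * coordSnd ^ b) = z ^ a * w ^ b := by
  refine (hasSum_seriesAt hz hw _).unique ?_
  convert hasSum_single (a, b) fun mn hmn => ?_ using 1
  · simp [coeff_monomial]
  · have : ¬ (a = mn.1 ∧ b = mn.2) := fun h => hmn (Prod.ext h.1.symm h.2.symm)
    simp [coeff_monomial, this]

lemma memAkl_of_mem_powerAlgebra {k l : ℕ} {f : C(Bidisk, ℂ)} (hf : f ∈ powerAlgebra k l) :
    memAkl k l f := by
  refine ⟨fun m n => coeff m n f, fun p hz hw => ?_, fun m n hmn => ?_⟩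
  · have h : seriesAt (p : ℂ × ℂ).1 (p : ℂ × ℂ).2 f = ContinuousMap.evalCLM ℂ p f :=
      eqOn_powerAlgebra (fun a b => by simp [seriesAt_monomial hz hw]) hf
    simpa [h] using hasSum_seriesAt hz hw f
  · refine eqOn_powerAlgebra (ψ := 0) (fun a b => ?_) hf
    rw [coeff_monomial, if_neg]
    · simp
    · rintro ⟨rfl, rfl⟩
      exact hmn ⟨dvd_mul_right _ _, dvd_mul_right _ _⟩

/-- The dilations `(z, w) ↦ (r z, r w)` of the closed bidisk, for `r` in the unit interval. -/
def dilation : C(unitInterval × Bidisk, Bidisk) where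
  toFun x := ⟨((x.1 : ℝ) * (x.2 : ℂ × ℂ).1, (x.1 : ℝ) * (x.2 : ℂ × ℂ).2), by
    obtain ⟨r, p⟩ := x
    have hp := mem_iff.1 p.2
    have hr : |(r : ℝ)| ≤ 1 := by rw [abs_of_nonneg r.2.1]; exact r.2.2
    simp only [mem_iff, norm_mul, Complex.norm_real, Real.norm_eq_abs]
    exact ⟨mul_le_one₀ hr (norm_nonneg _) hp.1, mul_le_one₀ hr (norm_nonneg _) hp.2⟩⟩
  continuous_toFun := by fun_prop

lemma mem_powerAlgebra_of_memAkl {k l : ℕ} {f : C(Bidisk, ℂ)} (hf : memAkl k l f) :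
    f ∈ powerAlgebra k l := by
  obtain ⟨a, ha, ha0⟩ := hf
  let F : C(unitInterval, C(Bidisk, ℂ)) := (f.comp dilation).curry
  have hF1 : F 1 = f := by
    ext p
    simp [F, dilation]
  have hlt : ∀ r ∈ Set.Iio (1 : unitInterval), F r ∈ powerAlgebra k l := by
    intro r hr
    have hr1 : ‖((r : ℝ) : ℂ)‖ < 1 := by
      rw [Complex.norm_real, Real.norm_of_nonneg r.2.1]; exact hr
    let q : Bidisk := ⟨((r : ℝ), (r : ℝ)), mem_iff.2 ⟨hr1.le, hr1.le⟩⟩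
    have hs : Summable fun mn : ℕ × ℕ => (a mn.1 mn.2 * (r : ℝ) ^ mn.1 * (r : ℝ) ^ mn.2) •
        (coordFst ^ mn.1 * coordSnd ^ mn.2) := by
      refine Summable.of_norm_bounded (ha q hr1 hr1).summable.norm fun mn => ?_
      rw [norm_smul]
      exact mul_le_of_le_one_right (norm_nonneg _) (norm_monomial_le _ _)
    have hsum : HasSum (fun mn : ℕ × ℕ => (a mn.1 mn.2 * (r : ℝ) ^ mn.1 * (r : ℝ) ^ mn.2) •
        (coordFst ^ mn.1 * coordSnd ^ mn.2)) (F r) := by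
      convert hs.hasSum
      ext p
      have hp := mem_iff.1 p.2
      have h1 := hs.hasSum.mapL (ContinuousMap.evalCLM ℂ p)
      refine HasSum.unique ?_ h1
      have h2 := ha (dilation (r, p))
        (by simpa only [dilation, ContinuousMap.coe_mk, norm_mul] using
          mul_lt_one_of_nonneg_of_lt_one_left (norm_nonneg _) hr1 hp.1)
        (by simpa only [dilation, ContinuousMap.coe_mk, norm_mul] using
          mul_lt_one_of_nonneg_of_lt_one_left (norm_nonneg _) hr1 hp.2)
      refine h2.congr_fun fun mn => ?_
      simp [dilation, mul_pow]
      ring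
    refine (isClosed_powerAlgebra k l).mem_of_tendsto hsum
      (Filter.Eventually.of_forall fun s => ?_)
    refine Subalgebra.sum_mem _ fun mn _ => ?_
    by_cases h : k ∣ mn.1 ∧ l ∣ mn.2
    · obtain ⟨⟨i, hi⟩, ⟨j, hj⟩⟩ := h
      refine Subalgebra.smul_mem _ ?_ _
      rw [hi, hj, pow_mul, pow_mul]
      exact mul_mem (pow_mem (coordFst_pow_mem k l) _) (pow_mem (coordSnd_pow_mem k l) _)
    · simp [ha0 _ _ h]
  have hcl : closure (Set.Iio (1 : unitInterval)) ⊆ F ⁻¹' (powerAlgebra k l) :=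
    closure_minimal hlt ((isClosed_powerAlgebra k l).preimage F.continuous)
  rw [closure_Iio' ⟨0, zero_lt_one⟩] at hcl
  simpa [hF1] using hcl (Set.mem_Iic.2 le_rfl)

lemma memAkl_iff {k l : ℕ} {f : C(Bidisk, ℂ)} : memAkl k l f ↔ f ∈ powerAlgebra k l :=
  ⟨mem_powerAlgebra_of_memAkl, memAkl_of_mem_powerAlgebra⟩

/-- Every character of the closed algebra generated by `z ^ k` and `w ^ l` is a point evaluation. -/
lemma exists_eq_eval {k l : ℕ} (hk : k ≠ 0) (hl : l ≠ 0) (χ : powerAlgebra k l →ₐ[ℂ] ℂ) :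
    ∃ p : Bidisk, ∀ f : powerAlgebra k l, χ f = (f : C(Bidisk, ℂ)) p := by
  have hroot : ∀ {j : ℕ}, j ≠ 0 → ∀ g : powerAlgebra k l, ‖g‖ ≤ 1 →
      ∃ c : ℂ, c ^ j = χ g ∧ ‖c‖ ≤ 1 := by
    intro j hj g hg
    obtain ⟨c, hc⟩ := IsAlgClosed.exists_pow_nat_eq (χ g) (Nat.pos_of_ne_zero hj)
    refine ⟨c, hc, ?_⟩
    rw [← pow_le_one_iff_of_nonneg (norm_nonneg _) hj, ← norm_pow, hc]
    exact (AlgHom.norm_apply_le_self χ g).trans hg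
  obtain ⟨z, hz, hz1⟩ := hroot hk ⟨coordFst ^ k, coordFst_pow_mem k l⟩
    ((norm_pow_le _ _).trans (pow_le_one₀ (norm_nonneg _) norm_coordFst_le))
  obtain ⟨w, hw, hw1⟩ := hroot hl ⟨coordSnd ^ l, coordSnd_pow_mem k l⟩
    ((norm_pow_le _ _).trans (pow_le_one₀ (norm_nonneg _) norm_coordSnd_le))
  let p : Bidisk := ⟨(z, w), mem_iff.2 ⟨hz1, hw1⟩⟩
  let ev : powerAlgebra k l →ₐ[ℂ] ℂ :=
    (ContinuousMap.evalAlgHom ℂ ℂ p).comp (powerAlgebra k l).val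
  refine ⟨p, fun f => ?_⟩
  have hχ : Continuous χ := map_continuous χ
  have hev : Continuous ev := map_continuous ev
  have hle : Algebra.adjoin ℂ {coordFst ^ k, coordSnd ^ l} ≤ powerAlgebra k l :=
    Subalgebra.le_topologicalClosure _
  have hadj : ∀ g (hg : g ∈ Algebra.adjoin ℂ {coordFst ^ k, coordSnd ^ l}),
      χ ⟨g, hle hg⟩ = ev ⟨g, hle hg⟩ := by
    intro g hg
    induction hg using Algebra.adjoin_induction with
    | mem x hx =>
      rcases hx with rfl | rfl
      · exact hz.symm
      · exact hw.symm
    | algebraMap r => exact (χ.commutes r).trans (ev.commutes r).symm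
    | add x y hx hy ihx ihy =>
      exact (map_add χ ⟨x, hle hx⟩ ⟨y, hle hy⟩).trans
        ((congrArg₂ _ ihx ihy).trans (map_add ev ⟨x, hle hx⟩ ⟨y, hle hy⟩).symm)
    | mul x y hx hy ihx ihy =>
      exact (map_mul χ ⟨x, hle hx⟩ ⟨y, hle hy⟩).trans
        ((congrArg₂ _ ihx ihy).trans (map_mul ev ⟨x, hle hx⟩ ⟨y, hle hy⟩).symm)
  have hdense : f ∈ closure {g : powerAlgebra k l |
      (g : C(Bidisk, ℂ)) ∈ Algebra.adjoin ℂ {coordFst ^ k, coordSnd ^ l}} := by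
    rw [closure_subtype]
    refine closure_mono ?_ f.2
    exact fun g hg => ⟨⟨g, hle hg⟩, hg, rfl⟩
  exact Set.EqOn.closure (f := χ) (g := ev) (s := {g : powerAlgebra k l |
      (g : C(Bidisk, ℂ)) ∈ Algebra.adjoin ℂ {coordFst ^ k, coordSnd ^ l}}) (fun g hg => hadj g hg)
    hχ hev hdense

end Bidisk

/-- every character of `A_{k,ℓ}(𝔻²)` is evaluation at a point of the closed
bidisk, and consequently every maximal ideal of `A_{k,ℓ}(𝔻²)` is of the form
`{f : f(λ,μ) = 0}` for some `(λ,μ)` in the closed bidisk. -/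
theorem stmt10 (k l : ℕ) (hk : 1 ≤ k) (hl : 1 ≤ l) :
    (∀ χ : C(Bidisk, ℂ) → ℂ,
      (∀ f g : C(Bidisk, ℂ), memAkl k l f → memAkl k l g → χ (f + g) = χ f + χ g) →
      (∀ (c : ℂ) (f : C(Bidisk, ℂ)), memAkl k l f → χ (c • f) = c * χ f) →
      (∀ f g : C(Bidisk, ℂ), memAkl k l f → memAkl k l g → χ (f * g) = χ f * χ g) →
      χ 1 = 1 →
      ∃ p : Bidisk, ∀ f : C(Bidisk, ℂ), memAkl k l f → χ f = f p) ∧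
    (∀ J : Set C(Bidisk, ℂ), IsMaxIdealIn {f : C(Bidisk, ℂ) | memAkl k l f} J →
      ∃ p : Bidisk, J = {f : C(Bidisk, ℂ) | memAkl k l f ∧ f p = 0}) := by
  simp only [Bidisk.memAkl_iff]
  have hk0 : k ≠ 0 := by omega
  have hl0 : l ≠ 0 := by omega
  refine ⟨fun χ hadd hsmul hmul hone => ?_, fun J hJ => ?_⟩
  · let ψ : Bidisk.powerAlgebra k l →ₐ[ℂ] ℂ := AlgHom.ofLinearMap
      { toFun := fun f => χ f
        map_add' := fun f g => hadd f g f.2 g.2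
        map_smul' := fun c f => hsmul c f f.2 } hone fun f g => hmul f g f.2 g.2
    obtain ⟨p, hp⟩ := Bidisk.exists_eq_eval hk0 hl0 ψ
    exact ⟨p, fun f hf => hp ⟨f, hf⟩⟩
  · obtain ⟨⟨hJS, h0, hadd, -, hmul⟩, hne, hmax⟩ := hJ
    let I : Ideal (Bidisk.powerAlgebra k l) :=
      { carrier := {f | (f : C(Bidisk, ℂ)) ∈ J}
        add_mem' := fun {f g} hf hg => hadd f hf g hg
        zero_mem' := h0
        smul_mem' := fun c f hf => (hmul c c.2 f hf).1 }
    have hI : I ≠ ⊤ := fun h => hne <| hJS.antisymm fun f hf =>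
      show (⟨f, hf⟩ : Bidisk.powerAlgebra k l) ∈ I from h ▸ Submodule.mem_top
    obtain ⟨M, hM, hIM⟩ := I.exists_le_maximal hI
    obtain ⟨p, hp⟩ := Bidisk.exists_eq_eval hk0 hl0
      (WeakDual.CharacterSpace.equivAlgHom M.toCharacterSpace)
    refine ⟨p, ?_⟩
    have hker : IsIdealIn (Bidisk.powerAlgebra k l : Set C(Bidisk, ℂ))
        {f | f ∈ Bidisk.powerAlgebra k l ∧ f p = 0} := by
      refine ⟨fun f hf => hf.1, ⟨zero_mem _, rfl⟩, fun f hf g hg => ⟨add_mem hf.1 hg.1, ?_⟩,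
        fun f hf => ⟨neg_mem hf.1, ?_⟩, fun f hf g hg =>
          ⟨⟨mul_mem hf hg.1, ?_⟩, ⟨mul_mem hg.1 hf, ?_⟩⟩⟩
      · simp [hf.2, hg.2]
      · simp [hf.2]
      · simp [hg.2]
      · simp [hg.2]
    have hJker : J ⊆ {f | f ∈ Bidisk.powerAlgebra k l ∧ f p = 0} := by
      refine fun f hf => ⟨hJS hf, ?_⟩
      rw [← hp ⟨f, hJS hf⟩]
      exact M.toCharacterSpace_apply_eq_zero_of_mem (hIM (show ⟨f, hJS hf⟩ ∈ I from hf))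
    rcases hmax _ hker hJker with h | h
    · exact h.symm
    · have h1 : (1 : C(Bidisk, ℂ)) ∈ {f | f ∈ Bidisk.powerAlgebra k l ∧ f p = 0} := by
        rw [h]; exact one_mem (Bidisk.powerAlgebra k l)
      exact absurd h1.2 one_ne_zero
end
end
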